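/- If a 3-connected graph contains two vertex-disjoint odd cycles, then it contains two cycles of consecutive even lengths. -/

import Mathlib

open SimpleGraph

/-- `G` contains two cycles of consecutive even lengths `2m` and `2m+2`. -/
def HasTwoConsecEvenCycles {V : Type*} (G : SimpleGraph V) : Prop :=
  ∃ (u v : V) (c₁ : G.Walk u u) (c₂ : G.Walk v v) (m : ℕ),
    c₁.IsCycle ∧ c₂.IsCycle ∧ 0 < m ∧ c₁.length = 2 * m ∧ c₂.length = 2 * m + 2

/-- `G` is `k`-connected: more than `k` vertices, and deleting any set of
fewer than `k` vertices leaves a connected graph. -/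
def KConnected {V : Type*} (k : ℕ) (G : SimpleGraph V) : Prop :=
  k + 1 ≤ Nat.card V ∧ ∀ S : Set V, S.ncard < k → (G.induce Sᶜ).Connected

namespace CEC

/-- There is a path of length `k` from `u` to `v` all of whose vertices lie in `S`. -/
def PathIn {V : Type*} (G : SimpleGraph V) (S : Set V) (u v : V) (k : ℕ) : Prop :=
  ∃ p : G.Walk u v, p.IsPath ∧ p.length = k ∧ ∀ w ∈ p.support, w ∈ S

/-- There is a path of length `k` from `u` to `v` whose vertex set is exactly `S`. -/
def ExPath {V : Type*} (G : SimpleGraph V) (S : Set V) (u v : V) (k : ℕ) : Prop :=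
  ∃ p : G.Walk u v, p.IsPath ∧ p.length = k ∧ ∀ w, w ∈ p.support ↔ w ∈ S

/-- There is a cycle of length `k` all of whose vertices lie in `S`. -/
def CycIn {V : Type*} (G : SimpleGraph V) (S : Set V) (k : ℕ) : Prop :=
  ∃ (u : V) (c : G.Walk u u), c.IsCycle ∧ c.length = k ∧ ∀ w ∈ c.support, w ∈ S

/-- A cycle of length `n` presented as a periodic sequence indexed by the integers. -/
structure CycSeq {V : Type*} (G : SimpleGraph V) (n : ℕ) (c : ℤ → V) : Prop where
  adj : ∀ i, G.Adj (c i) (c (i + 1))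
  inj : ∀ i j, c i = c j ↔ (n : ℤ) ∣ i - j
  three : 3 ≤ n

variable {V : Type*} {G : SimpleGraph V} {S T : Set V} {u v w : V} {k l : ℕ}

lemma PathIn.mono (h : PathIn G S u v k) (hS : S ⊆ T) : PathIn G T u v k := by
  obtain ⟨p, hp, hl, hs⟩ := h
  exact ⟨p, hp, hl, fun w hw => hS (hs w hw)⟩

lemma CycIn.mono (h : CycIn G S k) (hS : S ⊆ T) : CycIn G T k := by
  obtain ⟨a, p, hp, hl, hs⟩ := h
  exact ⟨a, p, hp, hl, fun w hw => hS (hs w hw)⟩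

lemma CycIn.three (h : CycIn G S k) : 3 ≤ k := by
  obtain ⟨a, p, hp, hl, hs⟩ := h
  exact hl ▸ hp.three_le_length

lemma PathIn.symm (h : PathIn G S u v k) : PathIn G S v u k := by
  obtain ⟨p, hp, hl, hs⟩ := h
  exact ⟨p.reverse, hp.reverse, by simpa using hl, fun w hw => hs w (by simpa using hw)⟩

lemma PathIn.nil (hu : u ∈ S) : PathIn G S u u 0 :=
  ⟨Walk.nil, by simp, rfl, by simpa using hu⟩

lemma PathIn.edge (h : G.Adj u v) : PathIn G {u, v} u v 1 :=
  ⟨h.toWalk, by simp [Walk.cons_isPath_iff, h.ne], rfl, by simp⟩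

lemma PathIn.left_mem (h : PathIn G S u v k) : u ∈ S := by
  obtain ⟨p, hp, hl, hs⟩ := h
  exact hs _ p.start_mem_support

lemma PathIn.right_mem (h : PathIn G S u v k) : v ∈ S := by
  obtain ⟨p, hp, hl, hs⟩ := h
  exact hs _ p.end_mem_support

lemma PathIn.pos (h : PathIn G S u v k) (hne : u ≠ v) : 1 ≤ k := by
  obtain ⟨p, hp, hl, hs⟩ := h
  rcases Nat.eq_zero_or_pos k with h0 | h0
  · exact absurd (Walk.eq_of_length_eq_zero (hl.trans h0)) hne
  · exact h0

lemma PathIn.trans (h1 : PathIn G S u v k) (h2 : PathIn G T v w l)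
    (hd : ∀ x ∈ S, x ∈ T → x = v) : PathIn G (S ∪ T) u w (k + l) := by
  obtain ⟨p, hp, hl, hs⟩ := h1
  obtain ⟨q, hq, hl2, hs2⟩ := h2
  refine ⟨p.append q, ?_, by simp [hl, hl2], ?_⟩
  · rw [Walk.isPath_def, Walk.support_append, List.nodup_append']
    refine ⟨hp.support_nodup, hq.support_nodup.tail, ?_⟩
    intro x hx hx2
    have h3 := hd x (hs x hx) (hs2 x (List.mem_of_mem_tail hx2))
    subst h3
    have := hq.support_nodup
    rw [Walk.support_eq_cons] at this
    exact (List.nodup_cons.mp this).1 hx2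
  · intro x hx
    rw [Walk.mem_support_append_iff] at hx
    exact hx.imp (hs x) (hs2 x)

lemma PathIn.close (h1 : PathIn G S u v k) (h2 : PathIn G T v u l)
    (hd : ∀ x ∈ S, x ∈ T → x = u ∨ x = v) (hk : 3 ≤ k + l) :
    CycIn G (S ∪ T) (k + l) := by
  obtain ⟨p, hp, hl, hs⟩ := h1
  obtain ⟨q, hq, hl2, hs2⟩ := h2
  refine ⟨u, p.append q, ?_, by simp [hl, hl2], ?_⟩
  · apply hp.isCycle_append hq
    · intro x hx hx2
      have h3 := hd x (hs x (List.mem_of_mem_tail hx)) (hs2 x (List.mem_of_mem_tail hx2))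
      have hn1 := hp.support_nodup
      rw [Walk.support_eq_cons] at hn1
      have hn2 := hq.support_nodup
      rw [Walk.support_eq_cons] at hn2
      rcases h3 with rfl | rfl
      · exact (List.nodup_cons.mp hn1).1 hx
      · exact (List.nodup_cons.mp hn2).1 hx2
    · omega
  · intro x hx
    rw [Walk.mem_support_append_iff] at hx
    exact hx.imp (hs x) (hs2 x)

lemma PathIn.ofWalk (p : G.Walk u v) (h : ∀ w ∈ p.support, w ∈ S) : ∃ k, PathIn G S u v k := by
  classical
  exact ⟨_, p.bypass, p.bypass_isPath, rfl, fun w hw => h w (p.support_bypass_subset_support hw)⟩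

lemma PathIn.comp (h1 : PathIn G S u v k) (h2 : PathIn G T v w l) :
    ∃ m, PathIn G (S ∪ T) u w m := by
  obtain ⟨p, hp, hl, hs⟩ := h1
  obtain ⟨q, hq, hl2, hs2⟩ := h2
  apply PathIn.ofWalk (p.append q)
  intro x hx
  rw [Walk.mem_support_append_iff] at hx
  exact hx.imp (hs x) (hs2 x)

lemma PathIn.exact (h : PathIn G S u v k) : ∃ S' ⊆ S, ExPath G S' u v k := by
  obtain ⟨p, hp, hl, hs⟩ := h
  exact ⟨{w | w ∈ p.support}, hs, p, hp, hl, fun w => Iff.rfl⟩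

lemma ExPath.path (h : ExPath G S u v k) : PathIn G S u v k := by
  obtain ⟨p, hp, hl, hs⟩ := h
  exact ⟨p, hp, hl, fun w hw => (hs w).1 hw⟩

lemma ExPath.symm (h : ExPath G S u v k) : ExPath G S v u k := by
  obtain ⟨p, hp, hl, hs⟩ := h
  exact ⟨p.reverse, hp.reverse, by simpa using hl, fun w => by simpa using hs w⟩

lemma ExPath.split (h : ExPath G S u v k) {y : V} (hy : y ∈ S) :
    ∃ S1 S2 k1 k2, ExPath G S1 u y k1 ∧ ExPath G S2 y v k2 ∧ S = S1 ∪ S2 ∧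
      (∀ x ∈ S1, x ∈ S2 → x = y) ∧ k1 + k2 = k := by
  obtain ⟨p, hp, hl, hs⟩ := h
  obtain ⟨q, r, hq, hr, rfl⟩ := hp.mem_support_iff_exists_append.mp ((hs y).2 hy)
  refine ⟨{w | w ∈ q.support}, {w | w ∈ r.support}, _, _, ⟨q, hq, rfl, fun w => Iff.rfl⟩,
    ⟨r, hr, rfl, fun w => Iff.rfl⟩, ?_, ?_, by simpa using hl⟩
  · ext x
    rw [← hs x, Walk.mem_support_append_iff]; rfl
  · intro x hx hx2
    by_contra hne
    exact hp.ne_of_mem_support_of_append hne hx hx2 rfl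

lemma CycSeq.of_walk {x : V} {b : G.Walk x x} (hb : b.IsCycle) :
    ∃ c, CycSeq G b.length c ∧ ∀ i, c i ∈ b.support := by
  have h3 := hb.three_le_length
  have hn : (0 : ℤ) < b.length := by omega
  refine ⟨fun i => b.getVert (i % b.length).toNat, ⟨?_, ?_, h3⟩, fun i => b.getVert_mem_support _⟩
  · intro i
    have h1 := Int.emod_nonneg i hn.ne'
    have h2 := Int.emod_lt_of_pos i hn
    have h4 : (i + 1) % b.length = (i % b.length + 1) % b.length := by simp
    rcases lt_or_ge (i % b.length + 1) b.length with h | h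
    · rw [h4, Int.emod_eq_of_lt (by omega) h]
      have : (i % (b.length : ℤ) + 1).toNat = (i % (b.length : ℤ)).toNat + 1 := by omega
      rw [this]
      exact b.adj_getVert_succ (by omega)
    · have h5 : i % (b.length : ℤ) + 1 = b.length := by omega
      rw [h4, h5, Int.emod_self]
      have := b.adj_getVert_succ (i := (i % (b.length : ℤ)).toNat) (by omega)
      have h6 : (i % (b.length : ℤ)).toNat + 1 = b.length := by omega
      rw [h6, Walk.getVert_length] at this
      simpa using this
  · intro i j
    have h1 := Int.emod_nonneg i hn.ne'
    have h2 := Int.emod_lt_of_pos i hn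
    have h1' := Int.emod_nonneg j hn.ne'
    have h2' := Int.emod_lt_of_pos j hn
    constructor
    · intro h
      have := hb.getVert_injOn' (by simp only [Set.mem_setOf_eq]; omega)
        (by simp only [Set.mem_setOf_eq]; omega) h
      apply Int.dvd_of_emod_eq_zero
      apply Int.emod_eq_emod_iff_emod_sub_eq_zero.mp
      omega
    · intro h
      have := Int.emod_eq_emod_iff_emod_sub_eq_zero.mpr (Int.emod_eq_zero_of_dvd h)
      simp only [this]

lemma CycIn.seq (h : CycIn G S k) : ∃ c, CycSeq G k c ∧ ∀ i, c i ∈ S := by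
  obtain ⟨a, p, hp, rfl, hs⟩ := h
  obtain ⟨c, hc, hc2⟩ := CycSeq.of_walk hp
  exact ⟨c, hc, fun i => hs _ (hc2 i)⟩

variable {n m : ℕ} {c d : ℤ → V}

lemma CycSeq.shift (hc : CycSeq G n c) (s : ℤ) : CycSeq G n (fun i => c (i + s)) where
  adj i := by have := hc.adj (i + s); rwa [add_right_comm] at this
  inj i j := by rw [hc.inj]; ring_nf
  three := hc.three

lemma CycSeq.neg (hc : CycSeq G n c) : CycSeq G n (fun i => c (-i)) where
  adj i := by
    have := (hc.adj (-i - 1)).symm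
    have e : -i - 1 + 1 = -i := by ring
    have e2 : -(i + 1) = -i - 1 := by ring
    rw [e] at this
    simpa only [e2] using this
  inj i j := by
    rw [hc.inj, ← dvd_neg]; ring_nf
  three := hc.three

lemma CycSeq.eq_of (hc : CycSeq G n c) {i j : ℤ} (h : c i = c j) (h1 : i - j < n)
    (h2 : j - i < n) : i = j := by
  have h3 := (hc.inj i j).1 h
  have := Int.eq_zero_of_abs_lt_dvd h3 (by rw [abs_lt]; omega)
  omega

lemma CycSeq.per (hc : CycSeq G n c) (i : ℤ) : c (i + n) = c i := by
  rw [hc.inj]; simp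

lemma CycSeq.per_mul (hc : CycSeq G n c) (i k : ℤ) : c (i + n * k) = c i := by
  rw [hc.inj]; simp

lemma CycSeq.rep (hc : CycSeq G n c) (a i : ℤ) : ∃ j, a ≤ j ∧ j < a + n ∧ c j = c i := by
  have hn : (0 : ℤ) < n := by have := hc.three; omega
  refine ⟨a + (i - a) % n, ?_, ?_, ?_⟩
  · have := Int.emod_nonneg (i - a) hn.ne'; omega
  · have := Int.emod_lt_of_pos (i - a) hn; omega
  · rw [hc.inj]
    have := Int.emod_add_mul_ediv (i - a) n
    exact ⟨-((i - a) / n), by linarith⟩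

/-- The set of vertices of the arc of `c` from index `i` to index `j`. -/
def Arc (c : ℤ → V) (i j : ℤ) : Set V := {v | ∃ k, i ≤ k ∧ k ≤ j ∧ c k = v}

lemma mem_arc {i j k : ℤ} (h1 : i ≤ k) (h2 : k ≤ j) : c k ∈ Arc c i j := ⟨k, h1, h2, rfl⟩

lemma arc_nat (hc : CycSeq G n c) (i : ℤ) (k : ℕ) (hk : k < n) :
    PathIn G (Arc c i (i + k)) (c i) (c (i + k)) k := by
  induction k with
  | zero => simpa using PathIn.nil (mem_arc (c := c) (i := i) (j := i + 0) le_rfl (by simp))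
  | succ k ih =>
    have h1 := ih (by omega)
    have h2 := PathIn.edge (hc.adj (i + k))
    have h3 := h1.trans h2 (by
      rintro x ⟨a, ha, hb, rfl⟩ hx
      rcases hx with hx | hx
      · exact hx
      · have := hc.eq_of hx (by omega) (by omega)
        omega)
    have e : i + ((k + 1 : ℕ) : ℤ) = i + k + 1 := by push_cast; ring
    rw [e]
    apply h3.mono
    rintro x (⟨a, ha, hb, rfl⟩ | (rfl | rfl))
    · exact mem_arc ha (by omega)
    · exact mem_arc (by omega) (by omega)
    · exact mem_arc (by omega) (by omega)

lemma CycSeq.arc (hc : CycSeq G n c) {i j : ℤ} (h1 : i ≤ j) (h2 : j < i + n) :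
    PathIn G (Arc c i j) (c i) (c j) (j - i).toNat := by
  have := arc_nat hc i (j - i).toNat (by omega)
  have e : i + ((j - i).toNat : ℤ) = j := by omega
  rwa [e] at this

lemma CycSeq.cyc (hc : CycSeq G n c) : CycIn G (Set.range c) n := by
  have h3 := hc.three
  have h1 := hc.arc (i := 0) (j := n - 1) (by omega) (by omega)
  have h2 := (PathIn.edge (hc.adj (n - 1)))
  have e : c ((n : ℤ) - 1 + 1) = c 0 := by
    have := hc.per 0
    rw [← this]; congr 1; ring
  rw [e] at h2
  have h4 := h1.close h2 (by
    rintro x _ (hx | hx)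
    · right; exact hx
    · left; exact hx) (by omega)
  have e2 : ((n : ℤ) - 1 - 0).toNat + 1 = n := by omega
  rw [e2] at h4
  apply h4.mono
  rintro x (⟨a, _, _, rfl⟩ | (rfl | rfl)) <;> simp

/-- Closing up two disjoint paths with two edges. -/
lemma PathIn.cross {x y : V} (h1 : PathIn G S u v k) (h2 : PathIn G T x y l)
    (hd : ∀ z ∈ S, z ∉ T) (hux : G.Adj u x) (hvy : G.Adj v y) (hk : 1 ≤ k + l) :
    CycIn G (S ∪ T) (k + l + 2) := by
  have a1 := h1.left_mem
  have a2 := h1.right_mem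
  have a3 := h2.left_mem
  have a4 := h2.right_mem
  have h3 := h1.trans (PathIn.edge hvy) (by
    rintro z hz (hz2 | hz2)
    · exact hz2
    · rw [hz2] at hz; exact absurd a4 (hd _ hz))
  have h4 := h2.symm.trans (PathIn.edge hux.symm) (by
    rintro z hz (hz2 | hz2)
    · exact hz2
    · rw [hz2] at hz; exact absurd hz (hd _ a1))
  have h5 := h3.close h4 (by
    rintro z (hz | (rfl | rfl)) (hz2 | (hz2 | hz2))
    · exact absurd hz2 (hd _ hz)
    · rw [hz2] at hz; exact absurd a3 (hd _ hz)
    · left; exact hz2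
    · exact absurd hz2 (hd _ a2)
    · rw [hz2] at a2; exact absurd a3 (hd _ a2)
    · left; exact hz2
    · right; rfl
    · right; rfl
    · left; exact hz2) (by omega)
  have e : k + 1 + (l + 1) = k + l + 2 := by omega
  rw [e] at h5
  apply h5.mono
  rintro z ((hz | (rfl | rfl)) | (hz | (rfl | rfl)))
  · exact Or.inl hz
  · exact Or.inl a2
  · exact Or.inr a4
  · exact Or.inr hz
  · exact Or.inr a3
  · exact Or.inl a1

lemma hasTwo (h1 : CycIn G S k) (h2 : CycIn G T (k + 2)) (he : k % 2 = 0) :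
    HasTwoConsecEvenCycles G := by
  have h3 := h1.three
  obtain ⟨a, p, hp, hl, hs⟩ := h1
  obtain ⟨b, q, hq, hl2, hs2⟩ := h2
  exact ⟨a, b, p, q, k / 2, hp, hq, by omega, by omega, by omega⟩

/-- Edge-cut form of 3-connectivity. -/
def Sep3 (G : SimpleGraph V) : Prop :=
  ∀ (Y : Set V) (a b y z : V), y ∈ Y → y ≠ a → y ≠ b → z ∉ Y → z ≠ a → z ≠ b →
    ∃ p q, p ∈ Y ∧ q ∉ Y ∧ p ≠ a ∧ p ≠ b ∧ q ≠ a ∧ q ≠ b ∧ G.Adj p q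

lemma walk_cut {V : Type*} {G : SimpleGraph V} {x y : V} (p : G.Walk x y) (Y : Set V)
    (hx : x ∈ Y) (hy : y ∉ Y) : ∃ a b, a ∈ Y ∧ b ∉ Y ∧ G.Adj a b := by
  induction p with
  | nil => exact absurd hx hy
  | @cons a b c h q ih =>
    by_cases hb : b ∈ Y
    · exact ih hb hy
    · exact ⟨a, b, hx, hb, h⟩

lemma KConnected.sep3 [Finite V] (h : KConnected 3 G) : Sep3 G := by
  intro Y a b y z hy hya hyb hz hza hzb
  have hc := h.2 {a, b} (by
    have := Set.ncard_insert_le a {b}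
    rw [Set.ncard_singleton] at this
    omega)
  have hy' : y ∈ ({a, b} : Set V)ᶜ := by simp [hya, hyb]
  have hz' : z ∈ ({a, b} : Set V)ᶜ := by simp [hza, hzb]
  obtain ⟨p⟩ := hc.preconnected ⟨y, hy'⟩ ⟨z, hz'⟩
  obtain ⟨⟨p, hp⟩, ⟨q, hq⟩, h1, h2, h3⟩ := walk_cut p {t | t.1 ∈ Y} hy hz
  simp only [Set.mem_compl_iff, Set.mem_insert_iff, Set.mem_singleton_iff, not_or] at hp hq
  exact ⟨p, q, h1, h2, hp.1, hp.2, hq.1, hq.2, by simpa using h3⟩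

end CEC

namespace CEC
variable {V : Type*} {G : SimpleGraph V} {S T : Set V} {u v w : V} {k l : ℕ}
variable {n m : ℕ} {c d : ℤ → V}

/-- Paths of both parities exist between `u` and `v` inside `B`. -/
def Both (G : SimpleGraph V) (B : Set V) (u v : V) : Prop :=
  ∀ e : ℕ, ∃ k, PathIn G B u v k ∧ k % 2 = e % 2

/-- Every two distinct vertices of `B` are joined by paths of both parities in `B`. -/
def BB (G : SimpleGraph V) (B : Set V) : Prop :=
  ∀ u ∈ B, ∀ v ∈ B, u ≠ v → Both G B u v

lemma first_hit {B : Set V} {x z : V} (p : G.Walk x z) (hS : ∀ w ∈ p.support, w ∈ S)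
    (hz : z ∈ B) : ∃ w ∈ B, w ∈ S ∧ ∃ k, PathIn G (S \ B ∪ {w}) x w k := by
  induction p with
  | nil => exact ⟨_, hz, hS _ (by simp), 0, PathIn.nil (Or.inr rfl)⟩
  | @cons a b c h q ih =>
    by_cases ha : a ∈ B
    · exact ⟨a, ha, hS _ (by simp), 0, PathIn.nil (Or.inr rfl)⟩
    · obtain ⟨w, hw, hwS, k, hk⟩ := ih (fun w hw => hS w (by simp [hw])) hz
      obtain ⟨k', hk'⟩ := (PathIn.edge h).comp hk
      refine ⟨w, hw, hwS, k', hk'.mono ?_⟩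
      rintro t ((rfl | rfl) | ht)
      · exact Or.inl ⟨hS _ (by simp), ha⟩
      · exact hk.left_mem
      · exact ht

lemma PathIn.first_hit {B : Set V} {x z : V} (h : PathIn G S x z k) (hz : z ∈ B) :
    ∃ w ∈ B, w ∈ S ∧ ∃ k, PathIn G (S \ B ∪ {w}) x w k := by
  obtain ⟨p, _, _, hp⟩ := h
  exact CEC.first_hit p hp hz

lemma Both.symm {B : Set V} (h : Both G B u v) : Both G B v u := fun e => by
  obtain ⟨k, h1, h2⟩ := h e
  exact ⟨k, h1.symm, h2⟩

lemma Both.mono {B : Set V} (h : Both G B u v) (hB : B ⊆ T) : Both G T u v := fun e => by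
  obtain ⟨k, h1, h2⟩ := h e
  exact ⟨k, h1.mono hB, h2⟩

lemma Both.pre {B : Set V} {x : V} (h : Both G B u v) (hp : PathIn G S x u k)
    (hd : ∀ t ∈ S, t ∈ B → t = u) : Both G (S ∪ B) x v := fun e => by
  obtain ⟨k', h1, h2⟩ := h (e + k)
  exact ⟨k + k', hp.trans h1 hd, by omega⟩

lemma ear_to {B E : Set V} {w w' : V} {e : ℕ} (hB : BB G B) (hw : w ∈ B) (hw' : w' ∈ B)
    (hne : w ≠ w') (hE : ExPath G E w w' e) (hEB : ∀ x ∈ E, x ∈ B → x = w ∨ x = w')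
    {x y : V} (hx : x ∈ E) (hxB : x ∉ B) (hy : y ∈ B) : Both G (B ∪ E) x y := by
  obtain ⟨S1, S2, k1, k2, h1, h2, rfl, h4, h5⟩ := hE.split hx
  by_cases hyw : w = y
  · subst hyw
    have := (hB w' hw' w hw hne.symm).pre h2.path (by
      intro t ht htB
      rcases hEB t (Or.inr ht) htB with rfl | rfl
      · exact absurd (h4 t h1.path.left_mem ht) (by rintro rfl; exact hxB htB)
      · rfl)
    apply this.mono
    rintro t (ht | ht)
    · exact Or.inr (Or.inr ht)
    · exact Or.inl ht
  · have := (hB w hw y hy hyw).pre h1.path.symm (by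
      intro t ht htB
      rcases hEB t (Or.inl ht) htB with rfl | rfl
      · rfl
      · exact absurd (h4 t ht h2.path.right_mem) (by rintro rfl; exact hxB htB))
    apply this.mono
    rintro t (ht | ht)
    · exact Or.inr (Or.inl ht)
    · exact Or.inl ht

lemma ear_two {B E1 E2 : Set V} {w w' : V} {e1 e2 : ℕ} {x y : V}
    (hB : BB G B) (hw : w ∈ B) (hw' : w' ∈ B)
    (hne : w ≠ w') (hE1 : ExPath G E1 w x e1) (hE2 : ExPath G E2 x w' e2)
    (h4 : ∀ t ∈ E1, t ∈ E2 → t = x)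
    (hEB : ∀ x ∈ E1 ∪ E2, x ∈ B → x = w ∨ x = w')
    (hxB : x ∉ B) (hyB : y ∉ B) (hy : y ∈ E1) (hxy : x ≠ y) :
    Both G (B ∪ (E1 ∪ E2)) x y := by
  obtain ⟨S1, S2, k1, k2, h1, h2, rfl, h5, h6⟩ := hE1.split hy
  have a1 := (hB w hw w' hw' hne).pre h1.path.symm (by
      intro t ht htB
      rcases hEB t (Or.inl (Or.inl ht)) htB with rfl | rfl
      · rfl
      · exact absurd (h4 t (Or.inl ht) hE2.path.right_mem) (by rintro rfl; exact hxB htB))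
  have a2 := a1.symm.pre hE2.path (by
    rintro t ht (ht2 | ht2)
    · have := h4 t (Or.inl ht2) ht
      subst this
      exact absurd (h5 t ht2 h2.path.right_mem) hxy
    · rcases hEB t (Or.inr ht) ht2 with rfl | rfl
      · exact absurd (h4 t (Or.inl h1.path.left_mem) ht) (by rintro rfl; exact hxB ht2)
      · rfl)
  apply a2.mono
  rintro t (ht | (ht | ht))
  · exact Or.inr (Or.inr ht)
  · exact Or.inr (Or.inl (Or.inl ht))
  · exact Or.inl ht

lemma ear_BB {B E : Set V} {w w' : V} {e : ℕ} (hB : BB G B) (hw : w ∈ B) (hw' : w' ∈ B)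
    (hne : w ≠ w') (hE : ExPath G E w w' e) (hEB : ∀ x ∈ E, x ∈ B → x = w ∨ x = w') :
    BB G (B ∪ E) := by
  intro x hx y hy hxy
  by_cases hxB : x ∈ B
  · by_cases hyB : y ∈ B
    · exact (hB x hxB y hyB hxy).mono Set.subset_union_left
    · exact (ear_to hB hw hw' hne hE hEB (hy.resolve_left hyB) hyB hxB).symm
  · have hx := hx.resolve_left hxB
    by_cases hyB : y ∈ B
    · exact ear_to hB hw hw' hne hE hEB hx hxB hyB
    · have hy := hy.resolve_left hyB
      obtain ⟨S1, S2, k1, k2, h1, h2, rfl, h5, h6⟩ := hE.split hx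
      rcases hy with hy | hy
      · exact ear_two hB hw hw' hne h1 h2 h5 hEB hxB hyB hy hxy
      · have := ear_two hB hw' hw hne.symm h2.symm h1.symm (fun t a b => h5 t b a)
          (fun t ht a => (hEB t ht.symm a).symm) hxB hyB hy hxy
        rwa [Set.union_comm S2 S1] at this

lemma odd_BB (hd : CycSeq G m d) (hm : m % 2 = 1) : BB G (Set.range d) := by
  rintro _ ⟨i, rfl⟩ _ ⟨j, rfl⟩ hne e
  obtain ⟨j', h1, h2, h3⟩ := hd.rep i j
  rw [← h3] at hne ⊢
  have hlt : i < j' := lt_of_le_of_ne h1 (by rintro rfl; exact hne rfl)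
  have hs : ∀ a b, Arc d a b ⊆ Set.range d := by rintro a b x ⟨q, _, _, rfl⟩; simp
  have p1 := (hd.arc h1 h2).mono (hs _ _)
  have p2 := ((hd.arc (i := j') (j := i + m) (by omega) (by omega)).mono (hs _ _)).symm
  rw [hd.per] at p2
  by_cases hh : (j' - i).toNat % 2 = e % 2
  · exact ⟨_, p1, hh⟩
  · exact ⟨_, p2, by omega⟩

/-- `w` is a gate of `x`. -/
def Gate (G : SimpleGraph V) (H B : Set V) (x w : V) : Prop :=
  w ∈ B ∧ ∃ k, PathIn G (H \ B ∪ {w}) x w k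

lemma gate_unique {H B : Set V} (hBH : B ⊆ H) (hB : BB G B)
    (hmax : ∀ B', B ⊆ B' → B' ⊆ H → BB G B' → B' ⊆ B) {x w w' : V}
    (h1 : Gate G H B x w) (h2 : Gate G H B x w') : w = w' := by
  obtain ⟨hw, k, hk⟩ := h1
  obtain ⟨hw', k', hk'⟩ := h2
  by_contra hne
  obtain ⟨P, hP, hPx⟩ := hk.exact
  obtain ⟨y, hyP, hyS, k2, hk2⟩ := hk'.symm.first_hit (B := P) hPx.path.left_mem
  obtain ⟨S1, S2, a1, a2, h1, h2, rfl, h5, h6⟩ := hPx.split hyP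
  have hyB : y ∉ B := by
    intro hy
    rcases hP hyP with ⟨_, h⟩ | h
    · exact h hy
    · rcases hyS with ⟨_, h'⟩ | h'
      · exact h' hy
      · exact hne (h.symm.trans h')
  have hp := hk2.trans h2.path (by
    rintro t (⟨_, ht⟩ | ht) ht2
    · exact absurd (Or.inr ht2) ht
    · exact ht)
  have hsub : (((H \ B ∪ {w'}) \ (S1 ∪ S2) ∪ {y}) ∪ S2) ⊆ (H \ B) ∪ {w, w'} := by
    rintro t ((⟨(ht | ht), _⟩ | ht) | ht)
    · exact Or.inl ht
    · exact Or.inr (Or.inr ht)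
    · rw [ht]
      rcases hP hyP with h | h
      · exact Or.inl h
      · exact Or.inr (Or.inl h)
    · rcases hP (Or.inr ht) with h | h
      · exact Or.inl h
      · exact Or.inr (Or.inl h)
  obtain ⟨E1, hE1, hE1x⟩ := hk2.exact
  have hyE : y ∈ E1 := hE1x.path.right_mem
  obtain ⟨q1, hq1, hql1, hqs1⟩ := hE1x
  obtain ⟨q2, hq2, hql2, hqs2⟩ := h2
  have hp2 : ExPath G (E1 ∪ S2) w' w (k2 + a2) := by
    have hcap : ∀ t ∈ E1, t ∈ S2 → t = y := by
      intro t ht ht2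
      rcases hE1 ht with ⟨_, h⟩ | h
      · exact absurd (Or.inr ht2) h
      · exact h
    refine ⟨q1.append q2, ?_, by simp [hql1, hql2], ?_⟩
    · rw [Walk.isPath_def, Walk.support_append, List.nodup_append']
      refine ⟨hq1.support_nodup, hq2.support_nodup.tail, ?_⟩
      intro t ht ht2
      have h3 := hcap t ((hqs1 t).1 ht) ((hqs2 t).1 (List.mem_of_mem_tail ht2))
      subst h3
      have := hq2.support_nodup
      rw [← Walk.cons_tail_support] at this
      exact (List.nodup_cons.mp this).1 ht2
    · intro t
      rw [Walk.mem_support_append_iff, hqs1, hqs2]; rfl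
  have hEs : E1 ∪ S2 ⊆ (H \ B) ∪ {w, w'} :=
    (Set.union_subset_union_left _ hE1).trans hsub
  have hBB := ear_BB hB hw' hw (Ne.symm hne) hp2 (by
    intro t ht htB
    rcases hEs ht with h | h
    · exact absurd htB h.2
    · exact h.symm)
  exact hyB (hmax _ Set.subset_union_left (by
    rintro t (ht | ht)
    · exact hBH ht
    · rcases hEs ht with h | (h | h)
      · exact h.1
      · rw [h]; exact hBH hw
      · rw [h]; exact hBH hw') hBB (Or.inr (Or.inl hyE)))

lemma gates [Finite V] (hd : CycSeq G m d) (hm : m % 2 = 1) {H : Set V}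
    (hdH : Set.range d ⊆ H) (hH : ∀ v ∈ H, ∃ k, PathIn G H (d 0) v k) :
    ∃ (B : Set V) (g : V → V), B ⊆ H ∧ Set.range d ⊆ B ∧ (∀ x ∈ H, g x ∈ B) ∧
      (∀ x ∈ B, g x = x) ∧
      (∀ x ∈ H, ∀ y ∈ H, G.Adj x y → y ∉ B → g x = g y) ∧
      (∀ x ∈ H, ∀ y ∈ H, g x ≠ g y → Both G H x y) := by
  classical
  obtain ⟨B, ⟨hBH, hdB, hB⟩, hmax⟩ := Set.Finite.exists_maximal
    (s := {B : Set V | B ⊆ H ∧ Set.range d ⊆ B ∧ BB G B}) (Set.toFinite _)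
    ⟨Set.range d, hdH, subset_rfl, odd_BB hd hm⟩
  have hmax' : ∀ B', B ⊆ B' → B' ⊆ H → BB G B' → B' ⊆ B := fun B' h1 h2 h3 =>
    hmax ⟨h2, hdB.trans h1, h3⟩ h1
  have hex : ∀ x ∈ H, ∃ w, Gate G H B x w := by
    intro x hx
    obtain ⟨k, hk⟩ := hH x hx
    obtain ⟨w, hw, _, k', hk'⟩ := hk.symm.first_hit (B := B) (hdB ⟨0, rfl⟩)
    exact ⟨w, hw, k', hk'⟩
  have huniq := fun {x w w' : V} => gate_unique (x := x) (w := w) (w' := w') hBH hB hmax'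
  have hsub : ∀ x w k t E, ExPath G E x w k → w ∈ B → E ⊆ H \ B ∪ {w} → t ∈ E →
      Gate G H B t w := by
    intro x w k t E hE hw hE2 ht
    obtain ⟨S1, S2, a1, a2, h1, h2, rfl, h5, h6⟩ := hE.split ht
    exact ⟨hw, a2, h2.path.mono (fun s hs => hE2 (Or.inr hs))⟩
  let g : V → V := fun x => if hx : x ∈ H then (hex x hx).choose else x
  have hg : ∀ x ∈ H, Gate G H B x (g x) := by
    intro x hx
    simp only [g, dif_pos hx]
    exact (hex x hx).choose_spec
  refine ⟨B, g, hBH, hdB, fun x hx => (hg x hx).1, ?_, ?_, ?_⟩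
  · intro x hx
    exact huniq (hg x (hBH hx)) ⟨hx, 0, PathIn.nil (Or.inr rfl)⟩
  · intro x hx y hy hxy hyB
    apply huniq (hg x hx)
    obtain ⟨hw, k, hk⟩ := hg y hy
    by_cases hxB : x ∈ B
    · have : Gate G H B y x := ⟨hxB, 1, (PathIn.edge hxy.symm).mono (by
        rintro t (rfl | rfl)
        · exact Or.inl ⟨hy, hyB⟩
        · exact Or.inr rfl)⟩
      rw [huniq ⟨hw, k, hk⟩ this]
      exact ⟨hxB, 0, PathIn.nil (Or.inr rfl)⟩
    · obtain ⟨k', hk'⟩ := (PathIn.edge hxy).comp hk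
      refine ⟨hw, k', hk'.mono ?_⟩
      rintro t ((rfl | rfl) | ht)
      · exact Or.inl ⟨hx, hxB⟩
      · exact Or.inl ⟨hy, hyB⟩
      · exact ht
  · intro x hx y hy hne
    obtain ⟨hw, k, hk⟩ := hg x hx
    obtain ⟨hw', k', hk'⟩ := hg y hy
    obtain ⟨E, hE, hEx⟩ := hk.exact
    obtain ⟨E', hE', hEx'⟩ := hk'.exact
    have hdis : ∀ t ∈ E, t ∉ E' := by
      intro t ht ht'
      exact hne (huniq (hsub x _ k t E hEx hw hE ht) (hsub y _ k' t E' hEx' hw' hE' ht'))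
    have b1 := (hB _ hw _ hw' hne).pre hEx.path (by
      intro t ht htB
      rcases hE ht with h | h
      · exact absurd htB h.2
      · exact h)
    have b2 := b1.symm.pre hEx'.path (by
      rintro t ht (ht2 | htB)
      · exact absurd ht (hdis t ht2)
      rcases hE' ht with h | h
      · exact absurd htB h.2
      · exact h)
    apply b2.symm.mono
    have e1 : E ⊆ H := hE.trans (by
      rintro t (ht | ht)
      · exact ht.1
      · rw [ht]; exact hBH hw)
    have e2 : E' ⊆ H := hE'.trans (by
      rintro t (ht | ht)
      · exact ht.1
      · rw [ht]; exact hBH hw')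
    exact Set.union_subset e2 (Set.union_subset e1 hBH)

end CEC

namespace CEC

section comb
variable {α : Type*} {F : ℤ → Set α} {l : ℤ}

lemma chain (s : ℤ) (hx : ∀ i, ∀ w ∈ F i, ∀ w' ∈ F (i + s), w = w') (a : ℤ) (N : ℕ)
    (hN : 2 ≤ N) (hne : ∀ k : ℕ, 1 ≤ k → k ≤ N → (F (a + k * s)).Nonempty) :
    ∃ w, ∀ k : ℕ, k ≤ N → ∀ x ∈ F (a + k * s), x = w := by
  have hst : ∀ k : ℕ, ∀ w ∈ F (a + k * s), ∀ w' ∈ F (a + (k + 1 : ℕ) * s), w = w' := by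
    intro k w hw w' hw'
    apply hx _ w hw w'
    have e : a + k * s + s = a + (k + 1 : ℕ) * s := by push_cast; ring
    rwa [e]
  obtain ⟨w, hw⟩ := hne 2 (by omega) hN
  have h1 : ∀ x ∈ F (a + (1 : ℕ) * s), x = w := fun x hx => hst 1 x hx w hw
  obtain ⟨v, hv⟩ := hne 1 (by omega) (by omega)
  have hvw := h1 v hv
  subst hvw
  have key : ∀ k : ℕ, k + 1 ≤ N → ∀ x ∈ F (a + (k + 1 : ℕ) * s), x = v := by
    intro k
    induction k with
    | zero => intro _ x hx; exact h1 x hx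
    | succ k ih =>
      intro hk x hx
      obtain ⟨y, hy⟩ := hne (k + 1) (by omega) (by omega)
      have := ih (by omega) y hy
      subst this
      exact (hst (k + 1) y hy x hx).symm
  refine ⟨v, fun k hk x hx => ?_⟩
  rcases k with _ | k
  · exact hst 0 x hx v hv
  · exact key k hk x hx

lemma chain' [Nonempty α] (s : ℤ) (hx : ∀ i, ∀ w ∈ F i, ∀ w' ∈ F (i + s), w = w') (a : ℤ) (N : ℕ)
    (hN : N ≠ 1) (hne : ∀ k : ℕ, 1 ≤ k → k ≤ N → (F (a + k * s)).Nonempty) :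
    ∃ w, ∀ k : ℕ, 1 ≤ k → k ≤ N → ∀ x ∈ F (a + k * s), x = w := by
  rcases Nat.lt_or_ge N 2 with h | h
  · obtain ⟨w⟩ := (inferInstance : Nonempty α)
    exact ⟨w, fun k h1 h2 => by omega⟩
  · obtain ⟨w, hw⟩ := chain s hx a N h hne
    exact ⟨w, fun k _ h2 => hw k h2⟩

lemma comb_odd (hl : 3 ≤ l) (hodd : l % 2 = 1)
    (hper : ∀ i j, 2 * l ∣ i - j → F i = F j)
    (hx : ∀ i, ∀ w ∈ F i, ∀ w' ∈ F (i + (l - 1)), w = w')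
    (u1 u2 : ℤ) (hu : (u2 - u1) % 2 = 1)
    (hne : ∀ i, ¬ 2 * l ∣ i - u1 → ¬ 2 * l ∣ i - u2 → (F i).Nonempty) :
    ∃ w, ∀ j, (j - u1) % 2 = 0 → ∀ x ∈ F j, x = w := by
  obtain ⟨w, hw⟩ := chain (l - 1) hx u1 (l - 1).toNat (by omega) (by
    intro k h1 h2
    apply hne
    · rintro ⟨t, ht⟩
      have h3 : l ∣ (k : ℤ) := ⟨k - 2 * t, by linarith⟩
      have := Int.le_of_dvd (by omega) h3
      omega
    · intro h
      have h3 : (2 : ℤ) ∣ u1 + k * (l - 1) - u2 := (Dvd.intro _ rfl).trans h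
      obtain ⟨p, hp⟩ : ∃ p, l - 1 = 2 * p := ⟨l / 2, by omega⟩
      rw [hp] at h3
      have : (k : ℤ) * (2 * p) = 2 * (k * p) := by ring
      omega)
  refine ⟨w, fun j hj x hxx => ?_⟩
  obtain ⟨h, hh⟩ : ∃ h, j - u1 = 2 * h := ⟨(j - u1) / 2, by omega⟩
  obtain ⟨p, hp⟩ : ∃ p, l - 1 = 2 * p := ⟨l / 2, by omega⟩
  have hk0 := Int.emod_nonneg (-(2 * h)) (by omega : l ≠ 0)
  have hk1 := Int.emod_lt_of_pos (-(2 * h)) (by omega : 0 < l)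
  have hdm := Int.emod_add_mul_ediv (-(2 * h)) l
  obtain ⟨k, hk⟩ := Int.eq_ofNat_of_zero_le hk0
  apply hw k (by omega)
  rw [hper _ j]
  · exact hxx
  · refine ⟨-h - p * (-(2 * h) / l), ?_⟩
    have e : (k : ℤ) = -(2 * h) - l * (-(2 * h) / l) := by omega
    rw [e]
    have : j = u1 + 2 * h := by omega
    rw [this]
    generalize -(2 * h) / l = t at *
    have : l = 2 * p + 1 := by omega
    subst this
    ring

lemma comb_even_one (hl : 2 ≤ l) (hev : l % 2 = 0)
    (hper : ∀ i j, 2 * l ∣ i - j → F i = F j)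
    (hx : ∀ i, ∀ w ∈ F i, ∀ w' ∈ F (i + (l - 1)), w = w')
    (u1 : ℤ) (hne : ∀ i, ¬ 2 * l ∣ i - u1 → (F i).Nonempty) :
    ∃ w, ∀ j, ∀ x ∈ F j, x = w := by
  obtain ⟨p, hp⟩ : ∃ p, l = 2 * p := ⟨l / 2, by omega⟩
  obtain ⟨w, hw⟩ := chain (l - 1) hx u1 (2 * l - 1).toNat (by omega) (by
    intro k h1 h2
    apply hne
    rintro ⟨t, ht⟩
    have h3 : 2 * l ∣ (k : ℤ) := ⟨t * (l - 1) - k * (p - 1), by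
      have : (k : ℤ) * (l - 1) = 2 * l * t := by linarith
      have h4 : (k : ℤ) * (l - 1) * (l - 1) = 2 * l * t * (l - 1) := by rw [this]
      subst hp
      linear_combination h4⟩
    have := Int.le_of_dvd (by omega) h3
    omega)
  refine ⟨w, fun j x hxx => ?_⟩
  have hk0 := Int.emod_nonneg ((j - u1) * (l - 1)) (by omega : 2 * l ≠ 0)
  have hk1 := Int.emod_lt_of_pos ((j - u1) * (l - 1)) (by omega : 0 < 2 * l)
  have hdm := Int.emod_add_mul_ediv ((j - u1) * (l - 1)) (2 * l)
  obtain ⟨k, hk⟩ := Int.eq_ofNat_of_zero_le hk0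
  apply hw k (by omega)
  rw [hper _ j]
  · exact hxx
  · rw [hk] at hdm
    generalize (j - u1) * (l - 1) / (2 * l) = t at *
    refine ⟨(j - u1) * (p - 1) - t * (l - 1), ?_⟩
    subst hp
    linear_combination (2 * p - 1) * hdm

lemma comb [Nonempty α] (hl : 2 ≤ l)
    (hper : ∀ i j, 2 * l ∣ i - j → F i = F j)
    (hx : ∀ i, ∀ w ∈ F i, ∀ w' ∈ F (i + (l - 1)), w = w')
    (u1 u2 : ℤ) (hu : (u2 - u1) % 2 = 1)
    (hne : ∀ i, ¬ 2 * l ∣ i - u1 → ¬ 2 * l ∣ i - u2 → (F i).Nonempty) :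
    ∃ w0 w1, ∀ j, ∀ x ∈ F j, x = w0 ∨ x = w1 := by
  rcases Int.emod_two_eq_zero_or_one l with hev | hodd
  · by_cases h2 : (F u2).Nonempty
    · obtain ⟨w, hw⟩ := comb_even_one hl hev hper hx u1 (fun i hi => by
        by_cases h : 2 * l ∣ i - u2
        · rw [hper _ _ h]; exact h2
        · exact hne i hi h)
      exact ⟨w, w, fun j x h => Or.inl (hw j x h)⟩
    by_cases h1 : (F u1).Nonempty
    · obtain ⟨w, hw⟩ := comb_even_one hl hev hper hx u2 (fun i hi => by
        by_cases h : 2 * l ∣ i - u1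
        · rw [hper _ _ h]; exact h1
        · exact hne i h hi)
      exact ⟨w, w, fun j x h => Or.inl (hw j x h)⟩
    obtain ⟨p, hp⟩ : ∃ p, l = 2 * p := ⟨l / 2, by omega⟩
    have hk0 := Int.emod_nonneg ((u2 - u1) * (l - 1)) (by omega : 2 * l ≠ 0)
    have hk1 := Int.emod_lt_of_pos ((u2 - u1) * (l - 1)) (by omega : 0 < 2 * l)
    have hdm := Int.emod_add_mul_ediv ((u2 - u1) * (l - 1)) (2 * l)
    obtain ⟨k0, hk⟩ := Int.eq_ofNat_of_zero_le hk0
    rw [hk] at hdm hk1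
    generalize (u2 - u1) * (l - 1) / (2 * l) = t at *
    have hk0odd : (k0 : ℤ) % 2 = 1 := by
      obtain ⟨q, hq⟩ : ∃ q, u2 - u1 = 2 * q + 1 := ⟨(u2 - u1) / 2, by omega⟩
      have : (k0 : ℤ) = 2 * (q * (2 * p - 1) + p - 1 - 2 * p * t) + 1 := by
        rw [hq] at hdm; subst hp; linear_combination hdm
      omega
    have inv : ∀ a : ℤ, 2 * l ∣ a * (l - 1) → 2 * l ∣ a := by
      rintro a ⟨b, hb⟩
      refine ⟨b * (l - 1) - a * (p - 1), ?_⟩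
      subst hp
      linear_combination (2 * p - 1) * hb
    have hu2 : 2 * l ∣ u1 + k0 * (l - 1) - u2 := by
      refine ⟨(u2 - u1) * (p - 1) - t * (l - 1), ?_⟩
      subst hp
      linear_combination (2 * p - 1) * hdm
    have nod : ∀ a : ℤ, 0 < a → a < 2 * l → ¬ 2 * l ∣ a := by
      intro a h0 h1 h
      have := Int.le_of_dvd h0 h
      omega
    obtain ⟨w0, hw0⟩ := chain' (l - 1) hx u1 (k0 - 1) (by omega) (by
      intro k h1 h2
      apply hne
      · intro h
        exact nod k (by omega) (by omega) (inv k (by convert h using 1; ring))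
      · intro h
        have := inv (k0 - k) ((dvd_sub hu2 h).trans (dvd_of_eq (by ring)))
        exact nod _ (by omega) (by omega) this)
    obtain ⟨w1, hw1⟩ := chain' (l - 1) hx u2 (2 * l - 1 - k0).toNat (by omega) (by
      intro k h1 h2
      apply hne
      · intro h
        have := inv (k0 + k) ((dvd_add hu2 h).trans (dvd_of_eq (by ring)))
        exact nod _ (by omega) (by omega) this
      · intro h
        exact nod k (by omega) (by omega) (inv k (by convert h using 1; ring)))
    refine ⟨w0, w1, fun j x hxx => ?_⟩
    have hj0 := Int.emod_nonneg ((j - u1) * (l - 1)) (by omega : 2 * l ≠ 0)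
    have hj1 := Int.emod_lt_of_pos ((j - u1) * (l - 1)) (by omega : 0 < 2 * l)
    have hjm := Int.emod_add_mul_ediv ((j - u1) * (l - 1)) (2 * l)
    obtain ⟨k, hkk⟩ := Int.eq_ofNat_of_zero_le hj0
    rw [hkk] at hjm hj1
    generalize (j - u1) * (l - 1) / (2 * l) = r at *
    have hj : 2 * l ∣ u1 + k * (l - 1) - j := by
      refine ⟨(j - u1) * (p - 1) - r * (l - 1), ?_⟩
      subst hp
      linear_combination (2 * p - 1) * hjm
    have hFj := hper _ _ hj
    rcases lt_trichotomy k k0 with h | h | h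
    · rcases Nat.eq_zero_or_pos k with h0 | h0
      · exfalso; apply h1
        subst h0
        refine ⟨x, ?_⟩
        have : F u1 = F j := by simpa using hFj
        rw [this]; exact hxx
      · left
        exact hw0 k h0 (by omega) x (by rw [hFj]; exact hxx)
    · exfalso; apply h2
      refine ⟨x, ?_⟩
      rw [← hper _ _ hu2, ← h, hFj]
      exact hxx
    · right
      apply hw1 (k - k0) (by omega) (by omega)
      rw [hper _ j]
      · exact hxx
      · rw [Nat.cast_sub h.le]
        exact (dvd_sub hj hu2).trans (dvd_of_eq (by ring))
  · obtain ⟨w0, hw0⟩ := comb_odd (by omega) hodd hper hx u1 u2 hu hne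
    obtain ⟨w1, hw1⟩ := comb_odd (by omega) hodd hper hx u2 u1 (by omega) (fun i a b => hne i b a)
    refine ⟨w0, w1, fun j x h => ?_⟩
    rcases Int.emod_two_eq_zero_or_one (j - u1) with h0 | h0
    · exact Or.inl (hw0 j h0 x h)
    · exact Or.inr (hw1 j (by omega) x h)

end comb
end CEC

namespace CEC
variable {V : Type*} {G : SimpleGraph V} {S T : Set V} {u v w : V} {k l : ℕ}
variable {n m : ℕ} {c d : ℤ → V}

lemma ear_lemma (hsep : Sep3 G) {X J : Set V} {b1 b2 x0 z0 : V} (hJ : J ⊆ X)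
    (hx0 : x0 ∈ J) (hx1 : x0 ≠ b1) (hx2 : x0 ≠ b2)
    (hz0 : z0 ∈ X) (hz0J : z0 ∉ J) (hz1 : z0 ≠ b1) (hz2 : z0 ≠ b2) :
    ∃ x ∈ J, x ≠ b1 ∧ x ≠ b2 ∧ ∃ y ∈ X, y ∉ J ∧ y ≠ b1 ∧ y ≠ b2 ∧ ∃ k,
      PathIn G (Xᶜ ∪ {x, y}) x y k := by
  let Y : Set V := {v | (v ∈ J ∧ v ≠ b1 ∧ v ≠ b2) ∨ (v ∉ X ∧ ∃ x ∈ J, x ≠ b1 ∧ x ≠ b2 ∧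
    ∃ k, PathIn G (Xᶜ ∪ {x}) x v k)}
  obtain ⟨p, q, hp, hq, hp1, hp2, hq1, hq2, hpq⟩ := hsep Y b1 b2 x0 z0 (Or.inl ⟨hx0, hx1, hx2⟩)
    hx1 hx2 (by
      rintro (h | h)
      · exact hz0J h.1
      · exact h.1 hz0) hz1 hz2
  have hqJ : q ∉ J := fun h => hq (Or.inl ⟨h, hq1, hq2⟩)
  obtain ⟨x, hxJ, hx1, hx2, k, hk⟩ : ∃ x ∈ J, x ≠ b1 ∧ x ≠ b2 ∧
      ∃ k, PathIn G (Xᶜ ∪ {x, q}) x q k := by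
    rcases hp with hp | ⟨hpX, x, hxJ, hx1, hx2, k, hk⟩
    · refine ⟨p, hp.1, hp1, hp2, 1, (PathIn.edge hpq).mono ?_⟩
      exact Set.subset_union_right
    · obtain ⟨k', hk'⟩ := hk.comp (PathIn.edge hpq)
      refine ⟨x, hxJ, hx1, hx2, k', hk'.mono ?_⟩
      rintro t ((ht | ht) | (rfl | ht))
      · exact Or.inl ht
      · exact Or.inr (Or.inl ht)
      · exact Or.inl hpX
      · exact Or.inr (Or.inr ht)
  refine ⟨x, hxJ, hx1, hx2, q, ?_, hqJ, hq1, hq2, k, hk⟩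
  by_contra hqX
  apply hq
  right
  refine ⟨hqX, x, hxJ, hx1, hx2, k, hk.mono ?_⟩
  rintro t (ht | (ht | ht))
  · exact Or.inl ht
  · exact Or.inr ht
  · rw [ht]; exact Or.inl hqX

lemma walk_cut_mem {x y : V} (p : G.Walk x y) (Y : Set V)
    (hx : x ∈ Y) (hy : y ∉ Y) :
    ∃ a b, a ∈ p.support ∧ b ∈ p.support ∧ a ∈ Y ∧ b ∉ Y ∧ G.Adj a b := by
  induction p with
  | nil => exact absurd hx hy
  | @cons a b c h q ih =>
    by_cases hb : b ∈ Y
    · obtain ⟨a', b', h1, h2, h3⟩ := ih hb hy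
      exact ⟨a', b', by simp [h1], by simp [h2], h3⟩
    · exact ⟨a, b, by simp, by simp, hx, hb, h⟩

/-- `v` has a neighbour in `H`. -/
def Att (G : SimpleGraph V) (H : Set V) (v : V) : Prop := ∃ x ∈ H, G.Adj x v

/-- The data extracted from a maximal choice of the connected set `H`. -/
structure Frame (G : SimpleGraph V) (H : Set V) (l : ℕ) (c : ℤ → V) : Prop where
  sep : Sep3 G
  two : 2 ≤ l
  hc : CycSeq G (2 * l) c
  hcH : ∀ i, c i ∉ H
  key : ∀ v, v ∉ H → Att G H v → ∀ S k, CycIn G S k → k % 2 = 0 → (∀ x ∈ S, x ∉ H) → v ∈ S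
  attC : ∀ v, v ∉ H → Att G H v → ∃ i, c i = v
  three : ∀ p q, ∃ v, v ∉ H ∧ Att G H v ∧ v ≠ p ∧ v ≠ q
  comb : ∀ u1 u2 : ℤ, (u2 - u1) % 2 = 1 →
    ∃ i, ¬ (2 * (l : ℤ)) ∣ i - u1 ∧ ¬ (2 * (l : ℤ)) ∣ i - u2 ∧ ¬ Att G H (c i)
  hpath : ∀ u v, Att G H u → Att G H v → ∃ x ∈ H, ∃ y ∈ H, ∃ p, PathIn G H x y p ∧
    G.Adj x u ∧ G.Adj y v

variable {H : Set V}

lemma Frame.shift (F : Frame G H l c) (s : ℤ) : Frame G H l (fun i => c (i + s)) where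
  sep := F.sep
  two := F.two
  hc := F.hc.shift s
  hcH i := F.hcH _
  key := F.key
  attC v hv ha := by
    obtain ⟨i, hi⟩ := F.attC v hv ha
    exact ⟨i - s, by simpa using hi⟩
  three := F.three
  comb u1 u2 h := by
    obtain ⟨i, h1, h2, h3⟩ := F.comb (u1 + s) (u2 + s) (by simpa using h)
    refine ⟨i - s, ?_, ?_, by simpa using h3⟩
    · rwa [show i - s - u1 = i - (u1 + s) by ring]
    · rwa [show i - s - u2 = i - (u2 + s) by ring]
  hpath := F.hpath

lemma Frame.neg (F : Frame G H l c) : Frame G H l (fun i => c (-i)) where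
  sep := F.sep
  two := F.two
  hc := F.hc.neg
  hcH i := F.hcH _
  key := F.key
  attC v hv ha := by
    obtain ⟨i, hi⟩ := F.attC v hv ha
    exact ⟨-i, by simpa using hi⟩
  three := F.three
  comb u1 u2 h := by
    obtain ⟨i, h1, h2, h3⟩ := F.comb (-u1) (-u2) (by omega)
    refine ⟨-i, ?_, ?_, by simpa using h3⟩
    · rwa [show -i - u1 = -(i - -u1) by ring, dvd_neg]
    · rwa [show -i - u2 = -(i - -u2) by ring, dvd_neg]
  hpath := F.hpath

lemma cyc4 {N : ℕ} (hc : CycSeq G N c) {a1 a2 b1 b2 x y : ℤ} (h1 : a1 ≤ a2) (h2 : a2 < b1)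
    (h4 : b2 < a1 + N) (hx1 : b1 ≤ x) (hx2 : x ≤ b2) (hy1 : b1 ≤ y) (hy2 : y ≤ b2)
    {p p' q : ℕ} {P P' : Set V}
    (hA : PathIn G (Arc c b1 b2) (c x) (c y) q) (hP : PathIn G P (c a1) (c x) p)
    (hP' : PathIn G P' (c a2) (c y) p')
    (hPc : ∀ i, c i ∈ P → c i = c a1 ∨ c i = c x)
    (hPc' : ∀ i, c i ∈ P' → c i = c a2 ∨ c i = c y)
    (hPP : ∀ v ∈ P, v ∈ P' → ∃ i, c i = v) (h3 : 3 ≤ p + q + (p' + (a2 - a1).toNat)) :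
    CycIn G ((P ∪ Arc c b1 b2) ∪ (P' ∪ Arc c a1 a2)) (p + q + (p' + (a2 - a1).toNat)) := by
  have e1 := hP.trans hA (by
    rintro t ht ⟨i, hi1, hi2, rfl⟩
    rcases hPc i ht with h | h
    · have := hc.eq_of h (by omega) (by omega); omega
    · exact h)
  have e2 := hP'.symm.trans (hc.arc h1 (by omega)).symm (by
    rintro t ht ⟨i, hi1, hi2, rfl⟩
    rcases hPc' i ht with h | h
    · exact h
    · have := hc.eq_of h (by omega) (by omega); omega)
  apply e1.close e2 _ h3
  rintro t (ht | ⟨i, hi1, hi2, rfl⟩) (ht2 | ⟨j, hj1, hj2, hj⟩)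
  · obtain ⟨i, rfl⟩ := hPP t ht ht2
    rcases hPc i ht with h | h
    · exact Or.inl h
    · rcases hPc' i ht2 with h' | h'
      · have := hc.eq_of (h.symm.trans h') (by omega) (by omega); omega
      · exact Or.inr h'
  · subst hj
    rcases hPc j ht with h | h
    · exact Or.inl h
    · have := hc.eq_of h (by omega) (by omega); omega
  · rcases hPc' i ht2 with h' | h'
    · have := hc.eq_of h' (by omega) (by omega); omega
    · exact Or.inr h'
  · have := hc.eq_of hj (by omega) (by omega); omega

/-- A path from `c i` to `c j` with interior outside `H` and the cycle. -/
def Ear (G : SimpleGraph V) (H : Set V) (c : ℤ → V) (i j : ℤ) (t : ℕ) : Prop :=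
  PathIn G ({v | v ∉ H ∧ ∀ i, c i ≠ v} ∪ {c i, c j}) (c i) (c j) t

lemma arc_cap {P : Set V} {i j a b : ℤ} (h : P ⊆ {v | v ∉ H ∧ ∀ i, c i ≠ v} ∪ {c a, c b}) :
    c i ∈ P → c i = c a ∨ c i = c b := by
  intro hi
  rcases h hi with h | h
  · exact absurd rfl (h.2 i)
  · exact h

lemma Frame.oddEar (F : Frame G H l c) {i j : ℤ} {t : ℕ} (hij : i < j) (hji : j < i + 2 * l)
    (hE : Ear G H c i j t) (h1 : 3 ≤ t + (j - i)) (h2 : 3 ≤ t + 2 * l - (j - i)) :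
    (t + (j - i)) % 2 = 1 := by
  have hc := F.hc
  by_contra hne
  have cyc1 := hE.close (hc.arc hij.le (by push_cast; omega)).symm (by
    rintro x (hx | hx) ⟨q, _, _, rfl⟩
    · exact absurd rfl (hx.2 q)
    · exact hx) (by omega)
  have p2 := hc.arc (i := j) (j := i + 2 * l) (by omega) (by push_cast; omega)
  have e : c (i + 2 * l) = c i := by have := hc.per i; push_cast at this; exact this
  rw [e] at p2
  have cyc2 := hE.close p2 (by
    rintro x (hx | hx) ⟨q, _, _, rfl⟩
    · exact absurd rfl (hx.2 q)
    · exact hx) (by omega)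
  obtain ⟨v, hvH, hva, hv1, hv2⟩ := F.three (c i) (c j)
  obtain ⟨a, rfl⟩ := F.attC v hvH hva
  obtain ⟨a', ha1, ha2, ha3⟩ := hc.rep i a
  rw [← ha3] at hvH hva hv1 hv2
  have hs : ∀ x y, ∀ z ∈ ({v | v ∉ H ∧ ∀ i, c i ≠ v} ∪ {c i, c j}) ∪ Arc c x y, z ∉ H := by
    rintro x y z ((hz | (rfl | rfl)) | ⟨_, _, _, rfl⟩)
    · exact hz.1
    · exact F.hcH _
    · exact F.hcH _
    · exact F.hcH _
  have k1 := F.key _ hvH hva _ _ cyc1 (by omega) (hs _ _)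
  have k2 := F.key _ hvH hva _ _ cyc2 (by omega) (hs _ _)
  have f1 : c a' ∈ Arc c i j := by
    rcases k1 with (hx | hx) | h
    · exact absurd rfl (hx.2 a')
    · rcases hx with hx | hx
      · exact absurd hx hv1
      · exact absurd hx hv2
    · exact h
  have f2 : c a' ∈ Arc c j (i + 2 * l) := by
    rcases k2 with (hx | hx) | h
    · exact absurd rfl (hx.2 a')
    · rcases hx with hx | hx
      · exact absurd hx hv1
      · exact absurd hx hv2
    · exact h
  obtain ⟨q1, hq1, hq2, hq3⟩ := f1
  obtain ⟨q2, hr1, hr2, hr3⟩ := f2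
  push_cast at ha2
  have g1 : q1 = a' := hc.eq_of hq3 (by push_cast; omega) (by push_cast; omega)
  subst g1
  have g0 : q1 ≠ j := by rintro rfl; exact hv2 rfl
  have g2 : q2 ≠ i + 2 * l := by rintro rfl; exact hv1 (by rw [← hr3, e])
  have := hc.eq_of hr3 (by push_cast; omega) (by push_cast; omega)
  omega

lemma exists_greatest {P : ℤ → Prop} {a k : ℤ} (h : a < k) (ha : P a) :
    ∃ b, a ≤ b ∧ b < k ∧ P b ∧ ∀ j, b < j → j < k → ¬ P j := by
  classical
  obtain ⟨b, ⟨h1, h2⟩, h3⟩ := Int.exists_greatest_of_bdd (P := fun b => b < k ∧ P b)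
    ⟨k, fun z hz => hz.1.le⟩ ⟨a, h, ha⟩
  exact ⟨b, h3 a ⟨h, ha⟩, h1, h2, fun j hj hk hP => absurd (h3 j ⟨hk, hP⟩) (by omega)⟩

lemma exists_least {P : ℤ → Prop} {a k : ℤ} (h : k < a) (ha : P a) :
    ∃ b, b ≤ a ∧ k < b ∧ P b ∧ ∀ j, k < j → j < b → ¬ P j := by
  classical
  obtain ⟨b, ⟨h1, h2⟩, h3⟩ := Int.exists_least_of_bdd (P := fun b => k < b ∧ P b)
    ⟨k, fun z hz => hz.1.le⟩ ⟨a, h, ha⟩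
  exact ⟨b, h3 a ⟨h, ha⟩, h1, h2, fun j hj hk hP => absurd (h3 j ⟨hj, hP⟩) (by omega)⟩

/-- An ear ending in `H` starts at an attached vertex. -/
lemma Frame.ear_not_H (F : Frame G H l c) {X : Set V} {x y : V} {t : ℕ} (hHX : H ⊆ X)
    (hcX : ∀ i, c i ∈ X) (hE : PathIn G (Xᶜ ∪ {x, y}) x y t) (hx : x ∉ H) (hxa : ¬ Att G H x) :
    y ∉ H := by
  intro hy
  obtain ⟨p, hp, hpl, hps⟩ := hE
  obtain ⟨a, b, ha, hb, haY, hbY, hab⟩ := walk_cut_mem p Hᶜ hx (by simpa using hy)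
  have hbH : b ∈ H := by simpa using hbY
  have haa : Att G H a := ⟨b, hbH, hab.symm⟩
  obtain ⟨i, hi⟩ := F.attC a haY haa
  rcases hps a ha with h | (h | h)
  · exact h (hi ▸ hcX i)
  · exact hxa (h ▸ haa)
  · exact haY (h ▸ hy)

end CEC

namespace CEC
variable {V : Type*} {G : SimpleGraph V} {S T : Set V} {u v w : V} {k l : ℕ}
variable {n m : ℕ} {c d : ℤ → V} {H : Set V}

/-- Vertices outside `H` and the cycle `c`. -/
def Out (H : Set V) (c : ℤ → V) : Set V := {v | v ∉ H ∧ ∀ i, c i ≠ v}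

/-- The cycle together with an ear starting at an unattached vertex and separating
attached vertices. -/
structure Theta (G : SimpleGraph V) (H : Set V) (l : ℕ) (c : ℤ → V) (s : ℤ) (t : ℕ)
    (S : Set V) : Prop where
  F : Frame G H l c
  s2 : 2 ≤ s
  s3 : s + 2 ≤ 2 * l
  hT : ExPath G S (c 0) (c s) t
  hS : S ⊆ Out H c ∪ {c 0, c s}
  h0 : ¬ Att G H (c 0)
  al : ∃ a, 0 < a ∧ a < s ∧ Att G H (c a)
  be : ∃ b, s < b ∧ b < 2 * l ∧ Att G H (c b)

variable {s : ℤ} {t : ℕ}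

lemma Theta.per (Θ : Theta G H l c s t S) (i : ℤ) : c (i + 2 * l) = c i := by
  have := Θ.F.hc.per i
  push_cast at this
  exact this

lemma Theta.neg (Θ : Theta G H l c s t S) : Theta G H l (fun i => c (-i)) (2 * l - s) t S := by
  have e : c (-(2 * l - s)) = c s := by
    rw [← Θ.per (-(2 * l - s))]; congr 1; ring
  have e2 : ∀ a, c (-(2 * l - a)) = c a := by
    intro a
    rw [← Θ.per (-(2 * l - a))]; congr 1; ring
  obtain ⟨a, ha1, ha2, ha3⟩ := Θ.al
  obtain ⟨b, hb1, hb2, hb3⟩ := Θ.be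
  refine ⟨Θ.F.neg, by have := Θ.s3; omega, by have := Θ.s2; omega, ?_, ?_, ?_, ?_, ?_⟩
  · simpa only [e2, neg_zero] using Θ.hT
  · simp only [neg_zero, e2]
    intro v hv
    rcases Θ.hS hv with h | h
    · exact Or.inl ⟨h.1, fun i => h.2 _⟩
    · exact Or.inr h
  · simpa using Θ.h0
  · exact ⟨2 * l - b, by omega, by omega, by simpa only [e2, neg_zero] using hb3⟩
  · exact ⟨2 * l - a, by omega, by omega, by simpa only [e2, neg_zero] using ha3⟩

lemma Theta.tpos (Θ : Theta G H l c s t S) : 1 ≤ t := by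
  apply Θ.hT.path.pos
  intro h
  have := Θ.F.hc.eq_of h (by have := Θ.s2; have := Θ.s3; push_cast; omega)
    (by have := Θ.s2; have := Θ.s3; push_cast; omega)
  have := Θ.s2
  omega

lemma Theta.par (Θ : Theta G H l c s t S) : (t + s) % 2 = 1 := by
  have h1 := Θ.s2
  have h2 := Θ.s3
  have h3 := Θ.tpos
  have := Θ.F.oddEar (i := 0) (j := s) (t := t) (by omega) (by omega)
    (Θ.hT.path.mono Θ.hS) (by omega) (by omega)
  simpa using this

lemma Frame.setH (F : Frame G H l c) {P P' : Set V} {i j i' j' x y x' y' : ℤ}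
    (h1 : P ⊆ Out H c ∪ {c i, c j}) (h2 : P' ⊆ Out H c ∪ {c i', c j'}) :
    ∀ z ∈ (P ∪ Arc c x y) ∪ (P' ∪ Arc c x' y'), z ∉ H := by
  rintro z ((h | ⟨_, _, _, rfl⟩) | (h | ⟨_, _, _, rfl⟩))
  · rcases h1 h with h | (rfl | rfl)
    · exact h.1
    · exact F.hcH _
    · exact F.hcH _
  · exact F.hcH _
  · rcases h2 h with h | (rfl | rfl)
    · exact h.1
    · exact F.hcH _
    · exact F.hcH _
  · exact F.hcH _

/-- index version of membership in the four-piece cycles -/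
lemma Frame.setI {P P' : Set V} {i j i' j' x y x' y' a : ℤ}
    (h1 : P ⊆ Out H c ∪ {c i, c j}) (h2 : P' ⊆ Out H c ∪ {c i', c j'})
    (h : c a ∈ (P ∪ Arc c x y) ∪ (P' ∪ Arc c x' y')) :
    c a = c i ∨ c a = c j ∨ c a = c i' ∨ c a = c j' ∨ (∃ q, x ≤ q ∧ q ≤ y ∧ c q = c a) ∨
      (∃ q, x' ≤ q ∧ q ≤ y' ∧ c q = c a) := by
  rcases h with (h | h) | (h | h)
  · rcases arc_cap (j := 0) h1 h with h | h <;> tauto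
  · right; right; right; right; left; exact h
  · rcases arc_cap (j := 0) h2 h with h | h <;> tauto
  · right; right; right; right; right; exact h

lemma Theta.nested (Θ : Theta G H l c s t S) {a b : ℤ} {t' : ℕ} {S' : Set V} (ha : 0 ≤ a)
    (hab : a + 2 ≤ b) (hb : b ≤ s) (hne : ¬ (a = 0 ∧ b = s)) (hT' : PathIn G S' (c a) (c b) t')
    (hS' : S' ⊆ Out H c ∪ {c a, c b}) (hcap : ∀ v ∈ S, v ∈ S' → ∃ i, c i = v) : False := by
  have h1 := Θ.s2
  have h2 := Θ.s3
  have h3 := Θ.tpos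
  have hc := Θ.F.hc
  have ht' : 1 ≤ t' := by
    apply hT'.pos
    intro h
    have := hc.eq_of h (by push_cast; omega) (by push_cast; omega)
    omega
  have hpar := Θ.par
  have hpar' := Θ.F.oddEar (i := a) (j := b) (t := t') (by omega) (by omega)
    (hT'.mono hS') (by omega) (by omega)
  have cyc := cyc4 hc (a1 := 0) (a2 := a) (b1 := b) (b2 := s) (x := s) (y := b) ha (by omega)
    (by push_cast; omega) hb le_rfl le_rfl hb (hc.arc (i := b) (j := s) hb (by push_cast; omega)).symm
    Θ.hT.path hT' (fun i => arc_cap (j := 0) Θ.hS) (fun i => arc_cap (j := 0) hS') hcap (by omega)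
  obtain ⟨q, hq1, hq2, hq3⟩ := Θ.be
  have := Θ.F.key _ (Θ.F.hcH q) hq3 _ _ cyc (by omega) (Θ.F.setH Θ.hS hS')
  rcases Frame.setI Θ.hS hS' this with h | h | h | h | ⟨r, hr1, hr2, h⟩ | ⟨r, hr1, hr2, h⟩ <;>
  · have := hc.eq_of h (by push_cast; omega) (by push_cast; omega)
    omega

lemma Theta.crossing (Θ : Theta G H l c s t S) {a b : ℤ} {t' : ℕ} {S' : Set V} (ha : 0 < a)
    (has : a < s) (hb : s < b) (hbl : b < 2 * l) (hT' : PathIn G S' (c a) (c b) t')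
    (hS' : S' ⊆ Out H c ∪ {c a, c b}) (hcap : ∀ v ∈ S, v ∈ S' → ∃ i, c i = v)
    (hatt : ¬ Att G H (c a)) : False := by
  have h1 := Θ.s2
  have h2 := Θ.s3
  have h3 := Θ.tpos
  have hc := Θ.F.hc
  have ht' : 1 ≤ t' := by
    apply hT'.pos
    intro h
    have := hc.eq_of h (by push_cast; omega) (by push_cast; omega)
    omega
  have hpar := Θ.par
  have hpar' := Θ.F.oddEar (i := a) (j := b) (t := t') (by omega) (by omega)
    (hT'.mono hS') (by omega) (by omega)
  have e : c (2 * l) = c 0 := by simpa using Θ.per 0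
  have cyc1 := cyc4 hc (a1 := 0) (a2 := a) (b1 := s) (b2 := b) (x := s) (y := b) ha.le (by omega)
    (by push_cast; omega) le_rfl hb.le hb.le le_rfl (hc.arc (i := s) (j := b) hb.le (by push_cast; omega))
    Θ.hT.path hT' (fun i => arc_cap (j := 0) Θ.hS) (fun i => arc_cap (j := 0) hS') hcap (by omega)
  have cyc2 := cyc4 hc (a1 := a) (a2 := s) (b1 := b) (b2 := 2 * l) (x := b) (y := 2 * l) has.le
    (by omega)
    (by push_cast; omega) le_rfl hbl.le hbl.le le_rfl
    (hc.arc (i := b) (j := 2 * l) hbl.le (by push_cast; omega))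
    hT' (by rw [e]; exact Θ.hT.path.symm) (fun i => arc_cap (j := 0) hS')
    (fun i hi => by rw [e]; exact (arc_cap (j := 0) Θ.hS hi).symm) (fun v a b => hcap v b a) (by omega)
  obtain ⟨v, hvH, hva, hv1, hv2⟩ := Θ.F.three (c s) (c b)
  obtain ⟨q0, rfl⟩ := Θ.F.attC v hvH hva
  obtain ⟨q, hq1, hq2, hq3⟩ := hc.rep 0 q0
  rw [← hq3] at hvH hva hv1 hv2
  push_cast at hq2
  have k1 := Θ.F.key _ hvH hva _ _ cyc1 (by omega) (Θ.F.setH Θ.hS hS')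
  have k2 := Θ.F.key _ hvH hva _ _ cyc2 (by omega) (Θ.F.setH hS' Θ.hS)
  have n1 : q ≠ 0 := by rintro rfl; exact Θ.h0 hva
  have n2 : q ≠ a := by rintro rfl; exact hatt hva
  have n3 : q ≠ s := by rintro rfl; exact hv1 rfl
  have n4 : q ≠ b := by rintro rfl; exact hv2 rfl
  have f1 : (0 ≤ q ∧ q ≤ a) ∨ (s ≤ q ∧ q ≤ b) := by
    rcases Frame.setI Θ.hS hS' k1 with h | h | h | h | ⟨r, hr1, hr2, h⟩ | ⟨r, hr1, hr2, h⟩ <;>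
    · have := hc.eq_of h (by push_cast; omega) (by push_cast; omega)
      omega
  have f2 : (a ≤ q ∧ q ≤ s) ∨ (b ≤ q ∧ q ≤ 2 * l) := by
    rcases Frame.setI hS' Θ.hS k2 with h | h | h | h | ⟨r, hr1, hr2, h⟩ | ⟨r, hr1, hr2, h⟩
    · have := hc.eq_of h (by push_cast; omega) (by push_cast; omega)
      omega
    · have := hc.eq_of h (by push_cast; omega) (by push_cast; omega)
      omega
    · have := hc.eq_of h (by push_cast; omega) (by push_cast; omega)
      omega
    · have := hc.eq_of h (by push_cast; omega) (by push_cast; omega)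
      omega
    · by_cases hr : r = 2 * l
      · subst hr
        rw [e] at h
        have := hc.eq_of h (by push_cast; omega) (by push_cast; omega)
        omega
      · have := hc.eq_of h (by push_cast; omega) (by push_cast; omega)
        omega
    · have := hc.eq_of h (by push_cast; omega) (by push_cast; omega)
      omega
  omega

lemma Theta.claim (Θ : Theta G H l c s t S) {k0 : ℤ} (hk0 : 0 < k0) (hks : k0 < s) :
    Att G H (c k0) := by
  by_contra hna
  have h1 := Θ.s2
  have h2 := Θ.s3
  have h3 := Θ.tpos
  have hc := Θ.F.hc
  have hpar := Θ.par
  obtain ⟨b1, hb0, hb1, hb2, hb3⟩ := exists_greatest (P := fun j => j = 0 ∨ Att G H (c j)) hk0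
    (Or.inl rfl)
  obtain ⟨b2, hd0, hd1, hd2, hd3⟩ := exists_least (P := fun j => j = s ∨ Att G H (c j)) hks
    (Or.inl rfl)
  have hatt : ∀ j, b1 < j → j < b2 → ¬ Att G H (c j) := by
    intro j hj1 hj2 hj
    rcases lt_trichotomy j k0 with h | h | h
    · exact hb3 j hj1 h (Or.inr hj)
    · exact hna (h ▸ hj)
    · exact hd3 j h hj2 (Or.inr hj)
  obtain ⟨be, hbe1, hbe2, hbe3⟩ := Θ.be
  have idx : ∀ i j : ℤ, c i = c j → 0 ≤ i → i < 2 * l → 0 ≤ j → j < 2 * l → i = j :=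
    fun i j h _ _ _ _ => hc.eq_of h (by push_cast; omega) (by push_cast; omega)
  obtain ⟨x, ⟨j, hj1, hj2, rfl⟩, hxb1, hxb2, y, hyX, hyJ, hy1, hy2, t', hT'⟩ :=
    ear_lemma Θ.F.sep (X := H ∪ Set.range c ∪ S) (J := {v | ∃ j, b1 < j ∧ j < b2 ∧ c j = v})
      (b1 := c b1) (b2 := c b2) (x0 := c k0) (z0 := c be)
      (by rintro v ⟨j, _, _, rfl⟩; exact Or.inl (Or.inr ⟨j, rfl⟩))
      ⟨k0, hb1, hd1, rfl⟩
      (fun h => by have := idx _ _ h; omega) (fun h => by have := idx _ _ h; omega)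
      (Or.inl (Or.inr ⟨be, rfl⟩))
      (by rintro ⟨j, hj1, hj2, h⟩; have := idx _ _ h; omega)
      (fun h => by have := idx _ _ h; omega) (fun h => by have := idx _ _ h; omega)
  have hyH : y ∉ H := Θ.F.ear_not_H (fun v hv => Or.inl (Or.inl hv))
    (fun i => Or.inl (Or.inr ⟨i, rfl⟩)) hT' (Θ.F.hcH j) (hatt j hj1 hj2)
  by_cases hyc : ∃ i, c i = y
  · obtain ⟨j0, rfl⟩ := hyc
    obtain ⟨j', hj'0, hj'1, hj'⟩ := hc.rep 0 j0
    rw [← hj'] at hT' hyJ hy1 hy2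
    push_cast at hj'1
    have n1 : j' ≠ b1 := by rintro rfl; exact hy1 rfl
    have n2 : j' ≠ b2 := by rintro rfl; exact hy2 rfl
    have n3 : ¬ (b1 < j' ∧ j' < b2) := fun h => hyJ ⟨j', h.1, h.2, rfl⟩
    have hS' : (H ∪ Set.range c ∪ S)ᶜ ∪ {c j, c j'} ⊆ Out H c ∪ {c j, c j'} := by
      apply Set.union_subset_union_left
      intro v hv
      exact ⟨fun h => hv (Or.inl (Or.inl h)), fun i h => hv (Or.inl (Or.inr ⟨i, h⟩))⟩
    have hcap : ∀ v ∈ S, v ∈ (H ∪ Set.range c ∪ S)ᶜ ∪ {c j, c j'} → ∃ i, c i = v := by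
      rintro v hv (h | (h | h))
      · exact absurd (Or.inr hv) h
      · exact ⟨j, h.symm⟩
      · exact ⟨j', h.symm⟩
    rcases lt_or_ge s j' with h | h
    · exact Θ.crossing (by omega) (by omega) h (by omega) hT' hS' hcap (hatt j hj1 hj2)
    · rcases lt_or_ge j' j with h' | h'
      · rw [Set.pair_comm] at hT' hS' hcap
        exact Θ.nested (a := j') (b := j) hj'0 (by omega) (by omega) (by omega) hT'.symm hS' hcap
      · exact Θ.nested (a := j) (b := j') (by omega) (by omega) h (by omega) hT' hS' hcap
  · have hyS : y ∈ S := by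
      rcases hyX with (h | h) | h
      · exact absurd h hyH
      · exact absurd h hyc
      · exact h
    obtain ⟨S1, S2, k1, k2, p1, p2, rfl, h5, h6⟩ := Θ.hT.split hyS
    have hjS : c j ∉ S1 ∪ S2 := by
      intro h
      rcases arc_cap (j := 0) Θ.hS h with h | h <;>
      · have := idx _ _ h; omega
    have hcap : ∀ v ∈ (H ∪ Set.range c ∪ (S1 ∪ S2))ᶜ ∪ {c j, y}, v ∈ S1 ∪ S2 → v = y := by
      rintro v (h | (h | h)) hv
      · exact absurd (Or.inr hv) h
      · exact absurd (h ▸ hv) hjS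
      · exact h
    have q1 := hT'.trans p1.symm.path (fun v a b => hcap v a (Or.inl b))
    have q2 := hT'.trans p2.path (fun v a b => hcap v a (Or.inr b))
    have hO : ∀ v ∈ (H ∪ Set.range c ∪ (S1 ∪ S2))ᶜ ∪ {c j, y}, v ∈ Out H c ∨ v = c j := by
      rintro v (h | (h | h))
      · exact Or.inl ⟨fun h' => h (Or.inl (Or.inl h')), fun i h' => h (Or.inl (Or.inr ⟨i, h'⟩))⟩
      · exact Or.inr h
      · rw [h]; exact Or.inl ⟨hyH, fun i h' => hyc ⟨i, h'⟩⟩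
    have hyj : c j ≠ y := fun h => hyc ⟨j, h⟩
    have ht' := hT'.pos hyj
    have hk1 := p1.path.pos (fun h => hyc ⟨0, h⟩)
    have hk2 := p2.path.pos (fun h => hyc ⟨s, h.symm⟩)
    have hs0 : c s ∉ S1 := fun h => by
      have := h5 _ h p2.path.right_mem
      exact hyc ⟨s, this⟩
    have hs1 : c 0 ∉ S2 := fun h => by
      have := h5 _ p1.path.left_mem h
      exact hyc ⟨0, this⟩
    have o1 := Θ.F.oddEar (i := 0) (j := j) (t := t' + k1) (by omega) (by omega)
      (q1.symm.mono (by
        rintro v (hv | hv)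
        · rcases hO v hv with h | h
          · exact Or.inl h
          · exact Or.inr (Or.inr h)
        · rcases Θ.hS (Or.inl hv) with h | (h | h)
          · exact Or.inl h
          · exact Or.inr (Or.inl h)
          · exact absurd (h ▸ hv) hs0)) (by push_cast; omega) (by push_cast; omega)
    have o2 := Θ.F.oddEar (i := j) (j := s) (t := t' + k2) (by omega) (by omega)
      (q2.mono (by
        rintro v (hv | hv)
        · rcases hO v hv with h | h
          · exact Or.inl h
          · exact Or.inr (Or.inl h)
        · rcases Θ.hS (Or.inr hv) with h | (h | h)
          · exact Or.inl h
          · exact absurd (h ▸ hv) hs1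
          · exact Or.inr (Or.inr h))) (by push_cast; omega) (by push_cast; omega)
    push_cast at o1 o2
    omega

lemma Theta.all (Θ : Theta G H l c s t S) {k : ℤ} (hk : 0 < k) (hkl : k < 2 * l) (hks : k ≠ s) :
    Att G H (c k) := by
  rcases lt_or_gt_of_ne hks with h | h
  · exact Θ.claim hk h
  · have := Θ.neg.claim (k0 := 2 * l - k) (by omega) (by omega)
    have e : c (-(2 * l - k)) = c k := by
      rw [← Θ.per (-(2 * l - k))]; congr 1; ring
    simpa only [e] using this

end CEC

namespace CEC
variable {V : Type*} {G : SimpleGraph V} {S T : Set V} {u v w : V} {k l : ℕ}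
variable {n m : ℕ} {c d : ℤ → V} {H : Set V} {s : ℤ} {t : ℕ}

lemma CycIn.cast {k' : ℕ} (h : CycIn G S k) (e : k = k') : CycIn G S k' := e ▸ h

lemma Theta.main (Θ : Theta G H l c s t S) (hs : s % 2 = 0) (hsl : s + 4 ≤ 2 * l) :
    HasTwoConsecEvenCycles G := by
  have h1 := Θ.s2
  have h2 := Θ.s3
  have h3 := Θ.tpos
  have hc := Θ.F.hc
  have hpar := Θ.par
  obtain ⟨r, hr⟩ : ∃ r, s = 2 * r := ⟨s / 2, by omega⟩
  have hv := Θ.all (k := r) (by omega) (by omega) (by omega)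
  have hw := Θ.all (k := l + r - 1) (by omega) (by omega) (by omega)
  obtain ⟨x, hx, y, hy, p, hp, hxv, hyw⟩ := Θ.F.hpath _ _ hv hw
  have hA : ∀ a b, ∀ z ∈ H, z ∉ Arc c a b := by
    rintro a b z hz ⟨i, _, _, rfl⟩
    exact Θ.F.hcH i hz
  have p1 := hc.arc (i := r) (j := l + r - 1) (by omega) (by push_cast; omega)
  have p2 := (hc.arc (i := l + r - 1) (j := r + 2 * l) (by omega) (by push_cast; omega)).symm
  rw [Θ.per] at p2
  have c1 := hp.cross p1 (hA _ _) hxv hyw (by omega)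
  have c2 := hp.cross p2 (hA _ _) hxv hyw (by omega)
  by_cases hpe : (p + l + 1) % 2 = 0
  · exact hasTwo (c1.cast (k' := p + l + 1) (by omega)) (c2.cast (by omega)) hpe
  have hSH : ∀ z ∈ H, z ∉ S := by
    intro z hz hzS
    rcases Θ.hS hzS with h | (h | h)
    · exact h.1 hz
    · exact Θ.F.hcH _ (h ▸ hz)
    · exact Θ.F.hcH _ (h ▸ hz)
  have hcap : ∀ i, c i ∈ S → c i = c 0 ∨ c i = c s := fun i => arc_cap (j := 0) Θ.hS
  have e : c (2 * l) = c 0 := by simpa using Θ.per 0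
  have q1 := ((hc.arc (i := 0) (j := r) (by omega) (by push_cast; omega)).symm.trans Θ.hT.path
    (by
      rintro z ⟨i, hi1, hi2, rfl⟩ hz
      rcases hcap i hz with h | h
      · exact h
      · have := hc.eq_of h (by push_cast; omega) (by push_cast; omega); omega)).trans
    (hc.arc (i := s) (j := l + r - 1) (by omega) (by push_cast; omega)) (by
      rintro z (⟨i, hi1, hi2, rfl⟩ | hz) ⟨j, hj1, hj2, hj⟩
      · have := hc.eq_of hj (by push_cast; omega) (by push_cast; omega); omega
      · subst hj
        rcases hcap j hz with h | h
        · have := hc.eq_of h (by push_cast; omega) (by push_cast; omega); omega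
        · exact h)
  have q2' := (hc.arc (i := l + r - 1) (j := 2 * l) (by omega) (by push_cast; omega)).symm
  rw [e] at q2'
  have q2 := ((hc.arc (i := r) (j := s) (by omega) (by push_cast; omega)).trans Θ.hT.path.symm
    (by
      rintro z ⟨i, hi1, hi2, rfl⟩ hz
      rcases hcap i hz with h | h
      · have := hc.eq_of h (by push_cast; omega) (by push_cast; omega); omega
      · exact h)).trans q2' (by
      rintro z (⟨i, hi1, hi2, rfl⟩ | hz) ⟨j, hj1, hj2, hj⟩
      · have := hc.eq_of hj (by push_cast; omega) (by push_cast; omega); omega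
      · subst hj
        rcases hcap j hz with h | h
        · exact h
        · have := hc.eq_of h (by push_cast; omega) (by push_cast; omega); omega)
  have hA2 : ∀ a b a' b', ∀ z ∈ H, z ∉ (Arc c a b ∪ S) ∪ Arc c a' b' := by
    rintro a b a' b' z hz ((h | h) | h)
    · exact hA _ _ z hz h
    · exact hSH z hz h
    · exact hA _ _ z hz h
  have c3 := hp.cross q1 (hA2 _ _ _ _) hxv hyw (by omega)
  have c4 := hp.cross q2 (hA2 _ _ _ _) hxv hyw (by omega)
  exact hasTwo (c3.cast (k' := p + l + 1 + t) (by omega)) (c4.cast (by omega)) (by omega)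

lemma Theta.final (Θ : Theta G H l c s t S) : HasTwoConsecEvenCycles G := by
  have h1 := Θ.s2
  have h2 := Θ.s3
  have hc := Θ.F.hc
  have hdv : ∀ i k, c k = c i → (2 * (l : ℤ)) ∣ i - k := by
    intro i k h
    have := (hc.inj i k).1 h.symm
    push_cast at this
    exact this
  rcases Int.emod_two_eq_zero_or_one s with hs | hs
  · by_cases hl : l = 2
    · subst hl
      obtain ⟨i, i1, i2, i3⟩ := Θ.F.comb 0 1 (by norm_num)
      obtain ⟨k, k1, k2, k3⟩ := hc.rep 0 i
      rw [← k3] at i3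
      have n0 : k ≠ 0 := by rintro rfl; exact i1 (hdv _ _ k3)
      have n1 : k ≠ 1 := by rintro rfl; exact i2 (hdv _ _ k3)
      by_cases hks : k = s
      · obtain ⟨v, v1, v2, v3, v4⟩ := Θ.F.three (c 1) (c 3)
        obtain ⟨j, rfl⟩ := Θ.F.attC v v1 v2
        obtain ⟨q, q1, q2, q3⟩ := hc.rep 0 j
        rw [← q3] at v1 v2 v3 v4
        have m0 : q ≠ 0 := by rintro rfl; exact Θ.h0 v2
        have m1 : q ≠ 1 := by rintro rfl; exact v3 rfl
        have m2 : q ≠ k := by rintro rfl; exact i3 v2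
        have m3 : q ≠ 3 := by rintro rfl; exact v4 rfl
        push_cast at *
        omega
      · exact absurd (Θ.all (by omega) (by push_cast at *; omega) hks) i3
    · have := Θ.F.two
      by_cases h4 : s + 4 ≤ 2 * l
      · exact Θ.main hs h4
      · exact Θ.neg.main (by omega) (by omega)
  · obtain ⟨i, i1, i2, i3⟩ := Θ.F.comb 0 s (by simpa using hs)
    obtain ⟨k, k1, k2, k3⟩ := hc.rep 0 i
    rw [← k3] at i3
    have n0 : k ≠ 0 := by rintro rfl; exact i1 (hdv _ _ k3)
    have n1 : k ≠ s := by rintro rfl; exact i2 (hdv _ _ k3)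
    exact absurd (Θ.all (by omega) (by push_cast at *; omega) n1) i3

lemma Frame.final (F : Frame G H l c) : HasTwoConsecEvenCycles G := by
  obtain ⟨i0, _, _, hi0⟩ := F.comb 0 1 (by norm_num)
  -- shift so that the unattached vertex has index zero
  have F1 := F.shift i0
  have h0 : ¬ Att G H ((fun i => c (i + i0)) 0) := by simpa using hi0
  clear hi0
  revert F1 h0
  generalize (fun i => c (i + i0)) = c'
  intro F h0
  have hc := F.hc
  have idx : ∀ i j : ℤ, c' i = c' j → i - j < 2 * l → j - i < 2 * l → i = j :=
    fun i j h _ _ => hc.eq_of h (by push_cast; omega) (by push_cast; omega)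
  have hl := F.two
  have att : ∀ v, v ∉ H → Att G H v → ∃ i : ℤ, 0 < i ∧ i < 2 * l ∧ c' i = v := by
    intro v hv hva
    obtain ⟨j, rfl⟩ := F.attC v hv hva
    obtain ⟨q, q1, q2, q3⟩ := hc.rep 0 j
    rw [← q3] at hva
    have : q ≠ 0 := by rintro rfl; exact h0 hva
    exact ⟨q, by omega, by push_cast at q2; omega, q3⟩
  obtain ⟨v, hv1, hv2, -, -⟩ := F.three (c' 0) (c' 0)
  obtain ⟨a, a1, a2, rfl⟩ := att v hv1 hv2
  obtain ⟨p, p1, p2, p3, p4⟩ := exists_least (P := fun j => Att G H (c' j)) a1 hv2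
  obtain ⟨e, e1, e2, e3, e4⟩ := exists_greatest (P := fun j => Att G H (c' j)) a2 hv2
  obtain ⟨v, hv1, hv2, hv3, hv4⟩ := F.three (c' p) (c' e)
  obtain ⟨b, b1, b2, rfl⟩ := att v hv1 hv2
  have hbp : p < b := by
    by_contra h
    rcases lt_or_eq_of_le (not_lt.mp h) with h | h
    · exact p4 b b1 h hv2
    · exact hv3 (by rw [h])
  have hbe : b < e := by
    by_contra h
    rcases lt_or_eq_of_le (not_lt.mp h) with h | h
    · exact e4 b h b2 hv2
    · exact hv4 (by rw [h])
  have per : ∀ i, c' (i + 2 * l) = c' i := by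
    intro i
    have := hc.per i
    push_cast at this
    exact this
  have ee : c' (e - 2 * l) = c' e := by rw [← per (e - 2 * l)]; congr 1; ring
  have hatt : ∀ j, e - 2 * l < j → j < p → ¬ Att G H (c' j) := by
    intro j hj1 hj2 hj
    rcases lt_trichotomy j 0 with h | h | h
    · rw [← per] at hj
      exact e4 _ (by omega) (by omega) hj
    · exact h0 (h ▸ hj)
    · exact p4 j h hj2 hj
  obtain ⟨x, ⟨j, hj1, hj2, rfl⟩, hxb1, hxb2, y, hyX, hyJ, hy1, hy2, t', hT'⟩ :=
    ear_lemma F.sep (X := H ∪ Set.range c') (J := {v | ∃ j, e - 2 * l < j ∧ j < p ∧ c' j = v})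
      (b1 := c' p) (b2 := c' (e - 2 * l)) (x0 := c' 0) (z0 := c' b)
      (by rintro v ⟨j, _, _, rfl⟩; exact Or.inr ⟨j, rfl⟩)
      ⟨0, by omega, p2, rfl⟩
      (fun h => by have := idx _ _ h; omega) (fun h => by have := idx _ _ h; omega)
      (Or.inr ⟨b, rfl⟩)
      (by rintro ⟨j, hj1, hj2, h⟩; have := idx _ _ h; omega)
      (fun h => by have := idx _ _ h; omega) (fun h => by rw [ee] at h; have := idx _ _ h; omega)
  have hyH : y ∉ H := F.ear_not_H (fun v hv => Or.inl hv)
    (fun i => Or.inr ⟨i, rfl⟩) hT' (F.hcH j) (hatt j hj1 hj2)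
  obtain ⟨j0, rfl⟩ := hyX.resolve_left hyH
  obtain ⟨j', hj'0, hj'1, hj'⟩ := hc.rep (e - 2 * l) j0
  rw [← hj'] at hT' hyJ hy1 hy2
  push_cast at hj'1
  have n1 : j' ≠ p := by rintro rfl; exact hy1 rfl
  have n2 : j' ≠ e - 2 * l := by rintro rfl; exact hy2 rfl
  have n3 : ¬ (e - 2 * l < j' ∧ j' < p) := fun h => hyJ ⟨j', h.1, h.2, rfl⟩
  obtain ⟨S', hS', hE⟩ := hT'.exact
  have Θ : Theta G H l (fun i => c' (i + j)) (j' - j) t' S' := by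
    refine ⟨F.shift j, by omega, by omega, ?_, ?_, ?_, ?_, ?_⟩
    · simpa using hE
    · intro v hv
      rcases hS' hv with h | h
      · exact Or.inl ⟨fun h' => h (Or.inl h'), fun i h' => h (Or.inr ⟨i + j, h'⟩)⟩
      · right; simpa using h
    · simpa using hatt j hj1 hj2
    · exact ⟨p - j, by omega, by omega, by simpa using p3⟩
    · exact ⟨e - j, by omega, by omega, by simpa using e3⟩
  exact Θ.final

end CEC

namespace CEC
variable {V : Type*} {G : SimpleGraph V} {S T : Set V} {u v w : V} {k l : ℕ}
variable {n m : ℕ} {c d : ℤ → V} {H : Set V} {s : ℤ} {t : ℕ}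

lemma CycSeq.avoid (hc : CycSeq G n c) (a b : V) : ∃ i, c i ≠ a ∧ c i ≠ b := by
  have h3 := hc.three
  by_contra h
  push Not at h
  have n01 : c 0 ≠ c 1 := fun e => by have := hc.eq_of e (by omega) (by omega); omega
  have n02 : c 0 ≠ c 2 := fun e => by have := hc.eq_of e (by omega) (by omega); omega
  have n12 : c 1 ≠ c 2 := fun e => by have := hc.eq_of e (by omega) (by omega); omega
  have h' : ∀ i, c i = a ∨ c i = b := fun i => by
    by_cases hi : c i = a
    · exact Or.inl hi
    · exact Or.inr (h i hi)
  rcases h' 0 with h0 | h0 <;> rcases h' 1 with h1 | h1 <;> rcases h' 2 with h2 | h2 <;>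
    first
    | exact n01 (h0.trans h1.symm)
    | exact n02 (h0.trans h2.symm)
    | exact n12 (h1.trans h2.symm)

theorem thmE [Finite V] (hsep : Sep3 G) (hS : CycIn G S k) (hk : k % 2 = 0)
    (hT : CycIn G T m) (hm : m % 2 = 1) (hdis : ∀ v ∈ S, v ∉ T) : HasTwoConsecEvenCycles G := by
  by_contra hno
  obtain ⟨d, hd, hdT⟩ := hT.seq
  obtain ⟨H, ⟨hdH, hcon, k', hk'e, hk'⟩, hmax⟩ := Set.Finite.exists_maximal
    (s := {H : Set V | Set.range d ⊆ H ∧ (∀ v ∈ H, ∃ k, PathIn G H (d 0) v k) ∧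
      ∃ k, k % 2 = 0 ∧ CycIn G Hᶜ k}) (Set.toFinite _)
    ⟨Set.range d, subset_rfl, by
      rintro _ ⟨i, rfl⟩
      obtain ⟨j, j1, j2, j3⟩ := hd.rep 0 i
      rw [← j3]
      refine ⟨_, (hd.arc j1 j2).mono ?_⟩
      rintro x ⟨q, _, _, rfl⟩
      exact ⟨q, rfl⟩, k, hk, hS.mono (by
        rintro v hv ⟨i, rfl⟩
        exact hdis _ hv (hdT i))⟩
  obtain ⟨l, rfl⟩ : ∃ l, k' = 2 * l := ⟨k' / 2, by omega⟩
  obtain ⟨c, hc, hcH⟩ := hk'.seq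
  have hl : 2 ≤ l := by have := hc.three; omega
  obtain ⟨B, g, hBH, hdB, gB, gid, gadj, gboth⟩ := gates hd hm hdH hcon
  have key : ∀ v, v ∉ H → Att G H v → ∀ S k, CycIn G S k → k % 2 = 0 → (∀ x ∈ S, x ∉ H) →
      v ∈ S := by
    rintro v hv ⟨x, hx, hxv⟩ S k hS hk hSH
    by_contra hvS
    have : insert v H ⊆ H := hmax ⟨hdH.trans (Set.subset_insert _ _), by
      intro y hy
      rcases hy with rfl | hy
      · obtain ⟨k1, hk1⟩ := hcon x hx
        obtain ⟨k2, hk2⟩ := hk1.comp (PathIn.edge hxv)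
        refine ⟨k2, hk2.mono ?_⟩
        rintro t (ht | (rfl | rfl))
        · exact Or.inr ht
        · exact Or.inr hx
        · exact Or.inl rfl
      · obtain ⟨k1, hk1⟩ := hcon y hy
        exact ⟨k1, hk1.mono (Set.subset_insert _ _)⟩, k, hk, hS.mono (by
        rintro t ht (rfl | ht2)
        · exact hvS ht
        · exact hSH t ht ht2)⟩ (Set.subset_insert _ _)
    exact hv (this (Set.mem_insert _ _))
  have attC : ∀ v, v ∉ H → Att G H v → ∃ i, c i = v := by
    intro v hv hva
    exact key v hv hva _ _ hc.cyc (by omega) (by rintro _ ⟨i, rfl⟩; exact hcH i)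
  have F : Frame G H l c := by
    refine ⟨hsep, hl, hc, hcH, key, attC, ?_, ?_, ?_⟩
    · intro p q
      obtain ⟨i, hi1, hi2⟩ := hd.avoid p q
      obtain ⟨j, hj1, hj2⟩ := hc.avoid p q
      obtain ⟨x, y, hx, hy, hx1, hx2, hy1, hy2, hxy⟩ := hsep H p q (d i) (c j) (hdH ⟨i, rfl⟩) hi1 hi2
        (hcH j) hj1 hj2
      exact ⟨y, hy, ⟨x, hx, hxy⟩, hy1, hy2⟩
    · intro u1 u2 hu
      by_contra hcon2
      push Not at hcon2
      have : Nonempty V := ⟨d 0⟩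
      obtain ⟨w0, w1, hw⟩ := comb (F := fun i => {w | ∃ x ∈ H, G.Adj x (c i) ∧ g x = w})
        (l := (l : ℤ)) (by omega) (by
          intro i j hij
          have : c i = c j := (hc.inj i j).2 (by push_cast; exact hij)
          simp only [this]) (by
          rintro i w ⟨x, hx, hxa, rfl⟩ w' ⟨y, hy, hya, rfl⟩
          by_contra hne
          obtain ⟨k1, hk1, hk2⟩ := gboth x hx y hy hne (l + 1)
          have hA : ∀ a b, ∀ z ∈ H, z ∉ Arc c a b := by
            rintro a b z hz ⟨i, _, _, rfl⟩
            exact hcH i hz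
          have p1 := hc.arc (i := i) (j := i + (l - 1)) (by omega) (by push_cast; omega)
          have p2 := (hc.arc (i := i + (l - 1)) (j := i + (2 * l : ℕ)) (by push_cast; omega)
            (by push_cast; omega)).symm
          rw [hc.per] at p2
          have c1 := hk1.cross p1 (hA _ _) hxa hya (by omega)
          have c2 := hk1.cross p2 (hA _ _) hxa hya (by push_cast; omega)
          exact hno (hasTwo (c1.cast (k' := k1 + l + 1) (by omega))
            (c2.cast (by push_cast; omega)) (by omega))) u1 u2 hu (by
          intro i h1 h2
          obtain ⟨x, hx, hxa⟩ := hcon2 i h1 h2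
          exact ⟨g x, x, hx, hxa, rfl⟩)
      obtain ⟨i, hi1, hi2⟩ := hd.avoid w0 w1
      obtain ⟨j, hj1, hj2⟩ := hc.avoid w0 w1
      have hgd : g (d i) = d i := gid _ (hdB ⟨i, rfl⟩)
      obtain ⟨p, q, hp, hq, hp1, hp2, hq1, hq2, hpq⟩ := hsep {x | x ∈ H ∧ g x ≠ w0 ∧ g x ≠ w1}
        w0 w1 (d i) (c j) ⟨hdH ⟨i, rfl⟩, by rwa [hgd], by rwa [hgd]⟩ hi1 hi2
        (fun h => hcH j h.1) hj1 hj2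
      obtain ⟨hpH, hpw0, hpw1⟩ := hp
      by_cases hqH : q ∈ H
      · have hqB : q ∉ B := by
          intro h
          apply hq
          have := gid q h
          exact ⟨hqH, by rwa [this], by rwa [this]⟩
        have := gadj p hpH q hqH hpq hqB
        exact hq ⟨hqH, by rwa [← this], by rwa [← this]⟩
      · obtain ⟨i, rfl⟩ := attC q hqH ⟨p, hpH, hpq⟩
        rcases hw i (g p) ⟨p, hpH, hpq, rfl⟩ with h | h
        · exact hpw0 h
        · exact hpw1 h
    · rintro u v ⟨x, hx, hxu⟩ ⟨y, hy, hyv⟩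
      obtain ⟨k1, hk1⟩ := hcon x hx
      obtain ⟨k2, hk2⟩ := hcon y hy
      obtain ⟨k3, hk3⟩ := hk1.symm.comp hk2
      exact ⟨x, hx, y, hy, k3, by simpa using hk3, hxu, hyv⟩
  exact hno F.final

end CEC

namespace CEC
variable {V : Type*} {G : SimpleGraph V} {S T : Set V} {u v w : V} {k l : ℕ}
variable {n m : ℕ} {c d : ℤ → V}

/-- No even cycle is disjoint from an odd cycle. -/
def NoEO (G : SimpleGraph V) : Prop :=
  ∀ (S T : Set V) (k k' : ℕ), CycIn G S k → k % 2 = 0 → CycIn G T k' → k' % 2 = 1 →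
    (∀ v ∈ S, v ∉ T) → False

lemma even_from_ear (hc : CycSeq G n c) (hn : n % 2 = 1) {P : Set V} {i j : ℤ} {e : ℕ}
    (hP : PathIn G P (c i) (c j) e) (hij : i < j) (hji : j < i + n)
    (hcap : ∀ q, c q ∈ P → c q = c i ∨ c q = c j) (h1 : 3 ≤ e + (j - i))
    (h2 : 3 ≤ e + n - (j - i)) : ∃ k, k % 2 = 0 ∧ CycIn G (P ∪ Set.range c) k := by
  have hs : ∀ a b, P ∪ Arc c a b ⊆ P ∪ Set.range c := by
    rintro a b x (hx | ⟨q, _, _, rfl⟩)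
    · exact Or.inl hx
    · exact Or.inr ⟨q, rfl⟩
  have cyc1 := (hP.close (hc.arc hij.le hji).symm (by
    rintro x hx ⟨q, _, _, rfl⟩
    exact hcap q hx) (by omega)).mono (hs _ _)
  have p2 := hc.arc (i := j) (j := i + n) (by omega) (by omega)
  rw [hc.per] at p2
  have cyc2 := (hP.close p2 (by
    rintro x hx ⟨q, _, _, rfl⟩
    exact hcap q hx) (by omega)).mono (hs _ _)
  by_cases h : (e + (j - i).toNat) % 2 = 0
  · exact ⟨_, h, cyc1⟩
  · exact ⟨_, by omega, cyc2⟩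

lemma no_chord (hE : NoEO G) (hc : CycSeq G n c) (hd : CycSeq G m d) (hn : n % 2 = 1)
    (hm : m % 2 = 1) (hdis : ∀ i j, c i ≠ d j) {i j : ℤ} (h1 : i + 1 < j) (h2 : j + 1 < i + n) :
    ¬ G.Adj (c i) (c j) := by
  intro h
  obtain ⟨k, hk, hC⟩ := even_from_ear hc hn (PathIn.edge h) (by omega) (by omega) (fun q h => h)
    (by push_cast; omega) (by push_cast; omega)
  apply hE _ _ _ _ hC hk hd.cyc hm
  rintro v ((rfl | rfl) | ⟨q, rfl⟩) ⟨r, hr⟩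
  · exact hdis _ _ hr.symm
  · exact hdis _ _ hr.symm
  · exact hdis _ _ hr.symm

lemma att_unique (hE : NoEO G) (hc : CycSeq G n c) (hd : CycSeq G m d) (hn : n % 2 = 1)
    (hm : m % 2 = 1) (hdis : ∀ i j, c i ≠ d j) {i j : ℤ} {p p' : V} {k : ℕ}
    (hp : PathIn G (Set.range c ∪ Set.range d)ᶜ p p' k) (h1 : G.Adj p (c i))
    (h2 : G.Adj p' (c j)) : c i = c j := by
  by_contra hne
  obtain ⟨j', a1, a2, a3⟩ := hc.rep i j
  rw [← a3] at hne h2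
  have hij : i < j' := lt_of_le_of_ne a1 (by rintro rfl; exact hne rfl)
  have e1 := (PathIn.edge h1.symm).trans hp (by
    rintro x (rfl | rfl) hx
    · exact absurd (Or.inl ⟨i, rfl⟩) hx
    · rfl)
  have e2 := e1.trans (PathIn.edge h2) (by
    rintro x hx (rfl | rfl)
    · rfl
    · rcases hx with (h | h) | h
      · exact absurd h (Ne.symm hne)
      · obtain rfl : c j' = p := h
        exact absurd (Or.inl ⟨j', rfl⟩) hp.left_mem
      · exact absurd (Or.inl ⟨j', rfl⟩) h)
  have hsub : ∀ x, x ∈ ({c i, p} ∪ (Set.range c ∪ Set.range d)ᶜ) ∪ {p', c j'} →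
      x = c i ∨ x = c j' ∨ x ∈ (Set.range c ∪ Set.range d)ᶜ := by
    rintro x (((h | h) | h) | (h | h))
    · exact Or.inl h
    · exact Or.inr (Or.inr (h ▸ hp.left_mem))
    · exact Or.inr (Or.inr h)
    · exact Or.inr (Or.inr (h ▸ hp.right_mem))
    · exact Or.inr (Or.inl h)
  obtain ⟨k', hk, hC⟩ := even_from_ear hc hn e2 hij (by omega) (by
    intro q hq
    rcases hsub _ hq with h | h | h
    · exact Or.inl h
    · exact Or.inr h
    · exact absurd (Or.inl ⟨q, rfl⟩) h) (by push_cast; omega) (by push_cast; omega)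
  apply hE _ _ _ _ hC hk hd.cyc hm
  rintro v (hv | ⟨q, rfl⟩) ⟨r, hr⟩
  · subst hr
    rcases hsub _ hv with h | h | h
    · exact hdis _ _ h.symm
    · exact hdis _ _ h.symm
    · exact h (Or.inr ⟨r, rfl⟩)
  · exact hdis _ _ hr.symm

lemma cover (hsep : Sep3 G) (hE : NoEO G) (hc : CycSeq G n c) (hd : CycSeq G m d)
    (hn : n % 2 = 1) (hm : m % 2 = 1) (hdis : ∀ i j, c i ≠ d j) (y : V) :
    y ∈ Set.range c ∪ Set.range d := by
  by_contra hy
  let X := Set.range c ∪ Set.range d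
  let Y : Set V := {v | ∃ k, PathIn G Xᶜ y v k}
  have hatt : ∀ {c d : ℤ → V} {n m : ℕ}, CycSeq G n c → CycSeq G m d → n % 2 = 1 → m % 2 = 1 →
      (∀ i j, c i ≠ d j) → Set.range c ∪ Set.range d = X →
      ∃ i, ∀ j, (∃ p ∈ Y, G.Adj p (c j)) → c j = c i := by
    intro c d n m hc hd hn hm hdis hX
    by_cases h : ∃ i, ∃ p ∈ Y, G.Adj p (c i)
    · obtain ⟨i, p, ⟨k, hp⟩, hpi⟩ := h
      refine ⟨i, ?_⟩
      rintro j ⟨p', ⟨k', hp'⟩, hpj⟩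
      obtain ⟨k2, hk2⟩ := hp'.symm.comp hp
      rw [Set.union_self, ← hX] at hk2
      exact att_unique hE hc hd hn hm hdis hk2 hpj hpi
    · exact ⟨0, fun j hj => absurd ⟨j, hj⟩ h⟩
  obtain ⟨i, hi⟩ := hatt hc hd hn hm hdis rfl
  obtain ⟨j, hj⟩ := hatt hd hc hm hn (fun a b => (hdis b a).symm) (Set.union_comm _ _)
  obtain ⟨z, hz1, hz2⟩ := hc.avoid (c i) (d j)
  obtain ⟨p, q, hp, hq, hp1, hp2, hq1, hq2, hpq⟩ := hsep Y (c i) (d j) y (c z)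
    ⟨0, PathIn.nil hy⟩ (by rintro rfl; exact hy (Or.inl ⟨i, rfl⟩))
    (by rintro rfl; exact hy (Or.inr ⟨j, rfl⟩))
    (by rintro ⟨k, hk⟩; exact hk.right_mem (Or.inl ⟨z, rfl⟩)) hz1 hz2
  by_cases hqX : q ∈ X
  · rcases hqX with ⟨r, rfl⟩ | ⟨r, rfl⟩
    · exact hq1 (hi r ⟨p, hp, hpq⟩)
    · exact hq2 (hj r ⟨p, hp, hpq⟩)
  · obtain ⟨k, hk⟩ := hp
    obtain ⟨k2, hk2⟩ := hk.comp (PathIn.edge hpq)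
    refine hq ⟨k2, hk2.mono ?_⟩
    rintro t (ht | (rfl | rfl))
    · exact ht
    · exact hk.right_mem
    · exact hqX

/-- Two disjoint odd cycles in a graph without an even cycle disjoint from an odd one. -/
structure Pair (G : SimpleGraph V) (n m : ℕ) (c d : ℤ → V) : Prop where
  no : ¬ HasTwoConsecEvenCycles G
  sep : Sep3 G
  noEO : NoEO G
  hc : CycSeq G n c
  hd : CycSeq G m d
  hn : n % 2 = 1
  hm : m % 2 = 1
  dis : ∀ i j, c i ≠ d j

lemma Pair.swap (P : Pair G n m c d) : Pair G m n d c :=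
  ⟨P.no, P.sep, P.noEO, P.hd, P.hc, P.hm, P.hn, fun i j => (P.dis j i).symm⟩

lemma Pair.shift (P : Pair G n m c d) (s t : ℤ) :
    Pair G n m (fun i => c (i + s)) (fun i => d (i + t)) :=
  ⟨P.no, P.sep, P.noEO, P.hc.shift s, P.hd.shift t, P.hn, P.hm, fun _ _ => P.dis _ _⟩

lemma Pair.negD (P : Pair G n m c d) : Pair G n m c (fun i => d (-i)) :=
  ⟨P.no, P.sep, P.noEO, P.hc, P.hd.neg, P.hn, P.hm, fun _ _ => P.dis _ _⟩

lemma Pair.nbrC (P : Pair G n m c d) (i : ℤ) : ∃ j, G.Adj (c i) (d j) := by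
  have h3 := P.hc.three
  obtain ⟨p, q, hp, hq, hp1, hp2, hq1, hq2, hpq⟩ := P.sep {c i} (c (i - 1)) (c (i + 1)) (c i) (d 0)
    rfl (fun h => by have := P.hc.eq_of h (by omega) (by omega); omega)
    (fun h => by have := P.hc.eq_of h (by omega) (by omega); omega)
    (fun h => P.dis i 0 h.symm) (P.dis _ _).symm (P.dis _ _).symm
  obtain rfl : p = c i := hp
  rcases cover P.sep P.noEO P.hc P.hd P.hn P.hm P.dis q with ⟨j, rfl⟩ | ⟨j, rfl⟩
  · obtain ⟨j', a1, a2, a3⟩ := P.hc.rep i j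
    rw [← a3] at hq1 hq2 hpq hq
    have n1 : j' ≠ i := by rintro rfl; exact hq rfl
    have n2 : j' ≠ i + 1 := by rintro rfl; exact hq2 rfl
    have n3 : j' ≠ i + n - 1 := by
      rintro rfl; apply hq1
      rw [← P.hc.per (i - 1)]; congr 1; ring
    exact absurd hpq (no_chord P.noEO P.hc P.hd P.hn P.hm P.dis (by omega) (by omega))
  · exact ⟨j, hpq⟩

lemma Pair.nbrD (P : Pair G n m c d) (j : ℤ) : ∃ i, G.Adj (c i) (d j) := by
  obtain ⟨i, hi⟩ := P.swap.nbrC j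
  exact ⟨i, hi.symm⟩

lemma Pair.perC (P : Pair G n m c d) {i i' j : ℤ} (h : G.Adj (c i) (d j)) (hi : (n : ℤ) ∣ i - i') :
    G.Adj (c i') (d j) := by
  rwa [← (P.hc.inj i i').2 hi]

lemma Pair.perD (P : Pair G n m c d) {i j j' : ℤ} (h : G.Adj (c i) (d j)) (hj : (m : ℤ) ∣ j - j') :
    G.Adj (c i) (d j') := by
  rwa [← (P.hd.inj j j').2 hj]

/-- A cycle made of an arc of `c`, an arc of `d` and two connecting edges. -/
structure XC (G : SimpleGraph V) (n m : ℕ) (c d : ℤ → V) (i i' j j' : ℤ) : Prop where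
  h1 : i ≤ i'
  h2 : i' < i + n
  h3 : j ≤ j'
  h4 : j' < j + m
  h5 : i < i' ∨ j < j'
  h6 : (G.Adj (c i) (d j) ∧ G.Adj (c i') (d j')) ∨ (G.Adj (c i) (d j') ∧ G.Adj (c i') (d j))

variable {i i' j j' p p' q q' : ℤ}

lemma XC.cyc (h : XC G n m c d i i' j j') (P : Pair G n m c d) :
    CycIn G (Arc c i i' ∪ Arc d j j') ((i' - i) + (j' - j) + 2).toNat := by
  have hdis : ∀ z ∈ Arc c i i', z ∉ Arc d j j' := by
    rintro z ⟨a, _, _, rfl⟩ ⟨b, _, _, hb⟩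
    exact P.dis a b hb.symm
  have a1 := P.hc.arc h.h1 h.h2
  have a2 := P.hd.arc h.h3 h.h4
  have := h.h1
  have := h.h3
  have := h.h5
  rcases h.h6 with ⟨e1, e2⟩ | ⟨e1, e2⟩
  · exact (a1.cross a2 hdis e1 e2 (by omega)).cast (by omega)
  · exact (a1.cross a2.symm hdis e1 e2 (by omega)).cast (by omega)

/-- Two disjoint cycles of this kind, the second of odd length. -/
lemma Pair.two (P : Pair G n m c d) (h : XC G n m c d i i' j j') (h' : XC G n m c d p p' q q')
    (a1 : i' < p) (a2 : p' < i + n) (a3 : j' < q) (a4 : q' < j + m)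
    (ho : ((p' - p) + (q' - q)) % 2 = 1) :
    ((i' - i) + (j' - j)) % 2 = 1 ∧ p = i' + 1 ∧ p' + 1 = i + n ∧ q = j' + 1 ∧ q' + 1 = j + m := by
  have c1 := h.cyc P
  have c2 := h'.cyc P
  obtain ⟨g1, g2, g3, g4, g5, -⟩ := h
  obtain ⟨g1', g2', g3', g4', g5', -⟩ := h'
  have hdis : ∀ z ∈ Arc c i i' ∪ Arc d j j', z ∉ Arc c p p' ∪ Arc d q q' := by
    rintro z (⟨a, b1, b2, rfl⟩ | ⟨a, b1, b2, rfl⟩) (⟨b, e1, e2, hb⟩ | ⟨b, e1, e2, hb⟩)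
    · have := P.hc.eq_of hb (by omega) (by omega); omega
    · exact P.dis _ _ hb.symm
    · exact P.dis _ _ hb
    · have := P.hd.eq_of hb (by omega) (by omega); omega
  have hodd : ((i' - i) + (j' - j)) % 2 = 1 := by
    by_contra hne
    exact P.noEO _ _ _ _ c1 (by omega) c2 (by omega) hdis
  obtain ⟨s1, hs1, hs1'⟩ := c1.seq
  obtain ⟨s2, hs2, hs2'⟩ := c2.seq
  have hcov : ∀ y, y ∈ (Arc c i i' ∪ Arc d j j') ∪ (Arc c p p' ∪ Arc d q q') := by
    intro y
    rcases cover P.sep P.noEO hs1 hs2 (by omega) (by omega) (by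
      intro a b hab
      exact hdis _ (hs1' a) (hab ▸ hs2' b)) y with ⟨a, rfl⟩ | ⟨a, rfl⟩
    · exact Or.inl (hs1' a)
    · exact Or.inr (hs2' a)
  have hC : ∀ r, i ≤ r → r < i + n → (r ≤ i' ∨ (p ≤ r ∧ r ≤ p')) := by
    intro r r1 r2
    rcases hcov (c r) with (⟨a, b1, b2, hb⟩ | ⟨a, b1, b2, hb⟩) | (⟨a, b1, b2, hb⟩ | ⟨a, b1, b2, hb⟩)
    · have := P.hc.eq_of hb (by omega) (by omega); omega
    · exact absurd hb.symm (P.dis _ _)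
    · have := P.hc.eq_of hb (by omega) (by omega); omega
    · exact absurd hb.symm (P.dis _ _)
  have hD : ∀ r, j ≤ r → r < j + m → (r ≤ j' ∨ (q ≤ r ∧ r ≤ q')) := by
    intro r r1 r2
    rcases hcov (d r) with (⟨a, b1, b2, hb⟩ | ⟨a, b1, b2, hb⟩) | (⟨a, b1, b2, hb⟩ | ⟨a, b1, b2, hb⟩)
    · exact absurd hb (P.dis _ _)
    · have := P.hd.eq_of hb (by omega) (by omega); omega
    · exact absurd hb (P.dis _ _)
    · have := P.hd.eq_of hb (by omega) (by omega); omega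
  have f1 := hC (i' + 1) (by omega) (by omega)
  have f2 := hC (i + n - 1) (by omega) (by omega)
  have f3 := hD (j' + 1) (by omega) (by omega)
  have f4 := hD (j + m - 1) (by omega) (by omega)
  exact ⟨hodd, by omega, by omega, by omega, by omega⟩

/-- symmetric parity clash -/
lemma Pair.clash (P : Pair G n m c d) (h : XC G n m c d i i' j j') (h' : XC G n m c d p p' q q')
    (a1 : i' < p) (a2 : p' < i + n) (a3 : j' < q) (a4 : q' < j + m)
    (ho : ((p' - p) + (q' - q) + ((i' - i) + (j' - j))) % 2 = 1) : False := by
  have c1 := h.cyc P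
  have c2 := h'.cyc P
  by_cases ho1 : ((p' - p) + (q' - q)) % 2 = 1
  · have := P.two h h' a1 a2 a3 a4 ho1
    omega
  · obtain ⟨g1, g2, g3, g4, g5, -⟩ := h
    obtain ⟨g1', g2', g3', g4', g5', -⟩ := h'
    refine P.noEO _ _ _ _ c2 (by omega) c1 (by omega) ?_
    rintro z (⟨b, e1, e2, rfl⟩ | ⟨b, e1, e2, rfl⟩) (⟨a, b1, b2, hb⟩ | ⟨a, b1, b2, hb⟩)
    · have := P.hc.eq_of hb (by omega) (by omega); omega
    · exact P.dis _ _ hb.symm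
    · exact P.dis _ _ hb
    · have := P.hd.eq_of hb (by omega) (by omega); omega

end CEC

namespace CEC
variable {V : Type*} {G : SimpleGraph V} {S T : Set V} {u v w : V} {k l : ℕ}
variable {n m : ℕ} {c d : ℤ → V}
variable {i i' j j' p p' q q' : ℤ}

lemma Pair.lens (P : Pair G n m c d) (h : XC G n m c d i i' j j') (h' : XC G n m c d p p' q q')
    (h1 : ((i' - i) + (j' - j)) % 2 = 0)
    (h2 : (p' - p) + (q' - q) = (i' - i) + (j' - j) + 2) : False := by
  have c1 := h.cyc P
  have c2 := h'.cyc P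
  obtain ⟨g1, g2, g3, g4, g5, -⟩ := h
  exact P.no (hasTwo c1 (c2.cast (by omega)) (by omega))

lemma Pair.nD (P : Pair G n m c d) (a j : ℤ) : ∃ r, a ≤ r ∧ r < a + n ∧ G.Adj (c r) (d j) := by
  obtain ⟨i, hi⟩ := P.nbrD j
  obtain ⟨r, h1, h2, h3⟩ := P.hc.rep a i
  exact ⟨r, h1, h2, h3 ▸ hi⟩

lemma Pair.nC (P : Pair G n m c d) (a i : ℤ) : ∃ q, a ≤ q ∧ q < a + m ∧ G.Adj (c i) (d q) := by
  obtain ⟨j, hj⟩ := P.nbrC i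
  obtain ⟨r, h1, h2, h3⟩ := P.hd.rep a j
  exact ⟨r, h1, h2, h3 ▸ hj⟩

lemma Pair.step (P : Pair G n m c d) (q : ℤ) (hq : q = 1 ∨ q = 2) :
    ∃ j i i', G.Adj (c i) (d j) ∧ G.Adj (c i') (d (j + q)) ∧ c i ≠ c i' := by
  by_contra hno
  have hE : ∀ j i i', G.Adj (c i) (d j) → G.Adj (c i') (d (j + q)) → c i = c i' := by
    intro j i i' h1 h2
    by_contra h
    exact hno ⟨j, i, i', h1, h2, h⟩
  obtain ⟨i0, hi0⟩ := P.nbrD 0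
  have key : ∀ k : ℕ, ∀ i, G.Adj (c i) (d (q * k)) → c i = c i0 := by
    intro k
    induction k with
    | zero =>
      intro i hi
      obtain ⟨i1, hi1⟩ := P.nbrD (0 + q)
      have hi' : G.Adj (c i) (d 0) := by simpa using hi
      rw [hE 0 i i1 hi' hi1, hE 0 i0 i1 hi0 hi1]
    | succ k ih =>
      intro i hi
      obtain ⟨i1, hi1⟩ := P.nbrD (q * k)
      have hi' : G.Adj (c i) (d (q * k + q)) := by
        have e : q * ((k + 1 : ℕ) : ℤ) = q * k + q := by push_cast; ring
        rwa [← e]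
      rw [← hE _ i1 i hi1 hi', ih i1 hi1]
  have h3 := P.hc.three
  have hm := P.hm
  obtain ⟨j, h1, h2, hj⟩ := P.nC 0 (i0 + 1)
  have : ∃ k : ℕ, (m : ℤ) ∣ j - q * k := by
    rcases hq with rfl | rfl
    · exact ⟨j.toNat, by rw [show j - 1 * (j.toNat : ℤ) = 0 by omega]; exact dvd_zero _⟩
    · by_cases he : j % 2 = 0
      · exact ⟨(j / 2).toNat, by
          rw [show j - 2 * ((j / 2).toNat : ℤ) = 0 by omega]; exact dvd_zero _⟩
      · exact ⟨((j + m) / 2).toNat, by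
          rw [show j - 2 * (((j + m) / 2).toNat : ℤ) = -m by omega]
          exact (dvd_refl _).neg_right⟩
  obtain ⟨k, hk⟩ := this
  have e := key k _ (P.perD hj hk)
  have := P.hc.eq_of e (by omega) (by omega)
  omega

lemma Pair.ne3 (P : Pair G n m c d) : n ≠ 3 := by
  intro h
  have hm3 := P.hd.three
  have f1 : ∃ i i' j, i' = i + 1 ∧ XC G n m c d i i' j (j + 1) := by
    obtain ⟨j, i, i', h1, h2, h3⟩ := P.step 1 (Or.inl rfl)
    obtain ⟨r, a1, a2, a3⟩ := P.hc.rep i i'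
    rw [← a3] at h2 h3
    have : r ≠ i := by rintro rfl; exact h3 rfl
    by_cases hr : r = i + 1
    · exact ⟨i, r, j, hr, ⟨by omega, by omega, by omega, by omega, by omega, Or.inl ⟨h1, h2⟩⟩⟩
    · refine ⟨r, i + 3, j, by omega, ⟨by omega, by omega, by omega, by omega, by omega,
        Or.inr ⟨h2, P.perC h1 ⟨-1, by omega⟩⟩⟩⟩
  have f2 : ∃ i i' j, i' = i + 2 ∧ XC G n m c d i i' j (j + 2) := by
    obtain ⟨j, i, i', h1, h2, h3⟩ := P.step 2 (Or.inr rfl)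
    obtain ⟨r, a1, a2, a3⟩ := P.hc.rep i i'
    rw [← a3] at h2 h3
    have : r ≠ i := by rintro rfl; exact h3 rfl
    by_cases hr : r = i + 2
    · exact ⟨i, r, j, hr, ⟨by omega, by omega, by omega, by omega, by omega, Or.inl ⟨h1, h2⟩⟩⟩
    · refine ⟨r, i + 3, j, by omega, ⟨by omega, by omega, by omega, by omega, by omega,
        Or.inr ⟨h2, P.perC h1 ⟨-1, by omega⟩⟩⟩⟩
  obtain ⟨a, a', b, ha, x1⟩ := f1
  obtain ⟨p, p', q, hp, x2⟩ := f2
  exact P.lens x1 x2 (by omega) (by omega)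

lemma Pair.n5 (P : Pair G n m c d) : 5 ≤ n := by
  have := P.ne3
  have := P.hc.three
  have := P.hn
  omega

lemma Pair.m5 (P : Pair G n m c d) : 5 ≤ m := P.swap.n5

variable {o r r' : ℤ}

lemma Pair.RQ0 (P : Pair G n m c d) (h0 : G.Adj (c 0) (d 0)) (h1 : G.Adj (c 1) (d o))
    (ho : o % 2 = 1) (o1 : 1 ≤ o) (o2 : o ≤ m) (r1 : 2 ≤ r) (rr : r ≤ r') (r2 : r' ≤ n - 1)
    (q1 : 1 ≤ q) (qq : q ≤ q') (q2 : q' ≤ o - 1) (hne : r < r' ∨ q < q')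
    (h6 : (G.Adj (c r) (d q) ∧ G.Adj (c r') (d q')) ∨ (G.Adj (c r) (d q') ∧ G.Adj (c r') (d q))) :
    r = 2 ∧ r' = n - 1 ∧ q = 1 ∧ q' = o - 1 := by
  have n5 := P.n5
  have m5 := P.m5
  have hm := P.hm
  have O : XC G n m c d 0 1 (o - m) 0 := ⟨by omega, by omega, by omega, by omega, by omega,
    Or.inr ⟨h0, P.perD h1 (by simp)⟩⟩
  have X : XC G n m c d r r' q q' := ⟨by omega, by omega, by omega, by omega, hne, h6⟩
  by_cases hp : ((r' - r) + (q' - q)) % 2 = 1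
  · have := P.two O X (by omega) (by omega) (by omega) (by omega) hp
    omega
  · exact (P.clash O X (by omega) (by omega) (by omega) (by omega) (by omega)).elim

lemma Pair.RQ (P : Pair G n m c d) (h0 : G.Adj (c 0) (d 0)) (h1 : G.Adj (c 1) (d o))
    (ho : o % 2 = 1) (o1 : 1 ≤ o) (o2 : o ≤ m) (r1 : 2 ≤ r) (r2 : r ≤ n - 1) (r1' : 2 ≤ r')
    (r2' : r' ≤ n - 1) (q1 : 1 ≤ q) (q2 : q ≤ o - 1) (q1' : 1 ≤ q') (q2' : q' ≤ o - 1)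
    (e : G.Adj (c r) (d q)) (e' : G.Adj (c r') (d q')) :
    (r = r' ∧ q = q') ∨ (((r = 2 ∧ r' = n - 1) ∨ (r = n - 1 ∧ r' = 2)) ∧
      ((q = 1 ∧ q' = o - 1) ∨ (q = o - 1 ∧ q' = 1))) := by
  by_cases hne : r = r' ∧ q = q'
  · exact Or.inl hne
  right
  rcases le_total r r' with hr | hr <;> rcases le_total q q' with hq | hq
  · have := P.RQ0 h0 h1 ho o1 o2 r1 hr r2' q1 hq q2' (by omega) (Or.inl ⟨e, e'⟩)
    omega
  · have := P.RQ0 h0 h1 ho o1 o2 r1 hr r2' q1' hq q2 (by omega) (Or.inr ⟨e, e'⟩)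
    omega
  · have := P.RQ0 h0 h1 ho o1 o2 r1' hr r2 q1 hq q2' (by omega) (Or.inr ⟨e', e⟩)
    omega
  · have := P.RQ0 h0 h1 ho o1 o2 r1' hr r2 q1' hq q2 (by omega) (Or.inl ⟨e', e⟩)
    omega

lemma Pair.nD3 (P : Pair G n m c d) (j : ℤ) : G.Adj (c 0) (d j) ∨ G.Adj (c 1) (d j) ∨
    ∃ r : ℤ, 2 ≤ r ∧ r ≤ n - 1 ∧ G.Adj (c r) (d j) := by
  obtain ⟨r, h1, h2, h3⟩ := P.nD 0 j
  by_cases e0 : r = 0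
  · subst e0; exact Or.inl h3
  by_cases e1 : r = 1
  · subst e1; exact Or.inr (Or.inl h3)
  exact Or.inr (Or.inr ⟨r, by omega, by omega, h3⟩)

lemma Pair.xc01 (P : Pair G n m c d) (hq : q < q') (hm : q' < q + m)
    (h : G.Adj (c 0) (d q) ∨ G.Adj (c 1) (d q)) (h' : G.Adj (c 0) (d q') ∨ G.Adj (c 1) (d q')) :
    ∃ a a' : ℤ, 0 ≤ a ∧ a' ≤ 1 ∧ XC G n m c d a a' q q' := by
  have n5 := P.n5
  rcases h with h | h <;> rcases h' with h' | h'
  · exact ⟨0, 0, by omega, by omega,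
      ⟨by omega, by omega, by omega, by omega, by omega, Or.inl ⟨h, h'⟩⟩⟩
  · exact ⟨0, 1, by omega, by omega,
      ⟨by omega, by omega, by omega, by omega, by omega, Or.inl ⟨h, h'⟩⟩⟩
  · exact ⟨0, 1, by omega, by omega,
      ⟨by omega, by omega, by omega, by omega, by omega, Or.inr ⟨h', h⟩⟩⟩
  · exact ⟨1, 1, by omega, by omega,
      ⟨by omega, by omega, by omega, by omega, by omega, Or.inl ⟨h, h'⟩⟩⟩

lemma Pair.stepA (P : Pair G n m c d) (h0 : G.Adj (c 0) (d 0)) (h1 : G.Adj (c 1) (d 0))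
    (r1 : 2 ≤ r) (r2 : r + 1 ≤ n - 1) (e : G.Adj (c r) (d 0)) (e' : G.Adj (c (r + 1)) (d 0)) :
    False := by
  have n5 := P.n5
  have m5 := P.m5
  have hm := P.hm
  have h1m : G.Adj (c 1) (d m) := P.perD h1 (by simp)
  have key : ∀ q q' : ℤ, q < q' → 1 ≤ q → q' ≤ 3 →
      (G.Adj (c 0) (d q) ∨ G.Adj (c 1) (d q)) → (G.Adj (c 0) (d q') ∨ G.Adj (c 1) (d q')) →
      False := by
    intro q q' a1 a2 a3 h h'
    obtain ⟨a, a', b1, b2, X⟩ := P.xc01 a1 (by omega) h h'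
    have Y : XC G n m c d r (r + 1) m m := ⟨by omega, by omega, by omega, by omega, by omega,
      Or.inl ⟨P.perD e (by simp), P.perD e' (by simp)⟩⟩
    have := P.two X Y (by omega) (by omega) (by omega) (by omega) (by omega)
    omega
  have key2 : ∀ q q' : ℤ, q < q' → 1 ≤ q → q' ≤ 3 →
      (∃ r : ℤ, 2 ≤ r ∧ r ≤ n - 1 ∧ G.Adj (c r) (d q)) →
      (∃ r : ℤ, 2 ≤ r ∧ r ≤ n - 1 ∧ G.Adj (c r) (d q')) → False := by
    rintro q q' a1 a2 a3 ⟨s, s1, s2, hs⟩ ⟨t, t1, t2, ht⟩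
    have := P.RQ h0 h1m (by omega) (by omega) le_rfl s1 s2 t1 t2 (by omega) (by omega) (by omega)
      (by omega) hs ht
    omega
  have k12 := key 1 2 (by omega) (by omega) (by omega)
  have k13 := key 1 3 (by omega) (by omega) (by omega)
  have k23 := key 2 3 (by omega) (by omega) (by omega)
  have l12 := key2 1 2 (by omega) (by omega) (by omega)
  have l13 := key2 1 3 (by omega) (by omega) (by omega)
  have l23 := key2 2 3 (by omega) (by omega) (by omega)
  have d1 := or_assoc.2 (P.nD3 1)
  have d2 := or_assoc.2 (P.nD3 2)
  have d3 := or_assoc.2 (P.nD3 3)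
  rcases d1 with d1 | d1 <;> rcases d2 with d2 | d2
  · exact k12 d1 d2
  · rcases d3 with d3 | d3
    · exact k13 d1 d3
    · exact l23 d2 d3
  · rcases d3 with d3 | d3
    · exact k23 d2 d3
    · exact l13 d1 d3
  · exact l12 d1 d2

lemma Pair.triA (P : Pair G n m c d) (hn : n = 5) (h0 : G.Adj (c 0) (d 0)) (h1 : G.Adj (c 1) (d 0))
    (h3 : G.Adj (c 3) (d 0)) (h2 : G.Adj (c 2) (d 1)) (h4 : G.Adj (c 4) (d (m - 1))) : False := by
  subst hn
  have m5 := P.m5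
  have hm := P.hm
  have h1m : G.Adj (c 1) (d m) := P.perD h1 (by simp)
  have h3m : G.Adj (c 3) (d m) := P.perD h3 (by simp)
  have mid : ∀ q : ℤ, 2 ≤ q → q ≤ m - 2 → G.Adj (c 0) (d q) ∨ G.Adj (c 1) (d q) := by
    intro q q1 q2
    rcases P.nD3 q with h | h | ⟨s, s1, s2, hs⟩
    · exact Or.inl h
    · exact Or.inr h
    · have := P.RQ h0 h1m (by omega) (by omega) le_rfl (r := 2) (q := 1) (by omega) (by omega)
        s1 s2 (by omega) (by omega) (by omega) (by omega) h2 hs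
      omega
  have e12 : G.Adj (c 1) (d 2) := by
    refine (mid 2 (by omega) (by omega)).resolve_left fun h => ?_
    have X : XC G 5 m c d 0 2 1 2 := ⟨by omega, by omega, by omega, by omega, by omega,
      Or.inr ⟨h, h2⟩⟩
    have Y : XC G 5 m c d 3 4 (m - 1) m := ⟨by omega, by omega, by omega, by omega, by omega,
      Or.inr ⟨h3m, h4⟩⟩
    exact P.clash X Y (by omega) (by omega) (by omega) (by omega) (by omega)
  have n1 : ¬ G.Adj (c 1) (d (m - 2)) := by
    intro h
    have X : XC G 5 m c d 2 3 0 1 := ⟨by omega, by omega, by omega, by omega, by omega,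
      Or.inr ⟨h2, h3⟩⟩
    have Y : XC G 5 m c d 4 6 (m - 2) (m - 1) := ⟨by omega, by omega, by omega, by omega, by omega,
      Or.inr ⟨h4, P.perC h (by norm_num)⟩⟩
    exact P.clash X Y (by omega) (by omega) (by omega) (by omega) (by omega)
  have e0 : G.Adj (c 0) (d (m - 2)) := (mid (m - 2) (by omega) (by omega)).resolve_right n1
  have X4 : XC G 5 m c d 1 2 1 2 := ⟨by omega, by omega, by omega, by omega, by omega,
      Or.inr ⟨e12, h2⟩⟩
  rcases mid 3 (by omega) (by omega) with h | h
  · have X6 : XC G 5 m c d 0 2 1 3 := ⟨by omega, by omega, by omega, by omega, by omega,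
      Or.inr ⟨h, h2⟩⟩
    exact P.lens X4 X6 (by omega) (by omega)
  · by_cases hm5 : m = 5
    · subst hm5
      exact n1 (by norm_num; exact h)
    · have X : XC G 5 m c d 1 1 2 3 := ⟨by omega, by omega, by omega, by omega, by omega,
        Or.inl ⟨e12, h⟩⟩
      have Y : XC G 5 m c d 4 5 (m - 2) (m - 1) := ⟨by omega, by omega, by omega, by omega,
        by omega, Or.inr ⟨h4, P.perC e0 (by norm_num)⟩⟩
      exact P.clash X Y (by omega) (by omega) (by omega) (by omega) (by omega)

lemma Pair.notri0 (P : Pair G n m c d) (h0 : G.Adj (c 0) (d 0)) (h1 : G.Adj (c 1) (d 0)) :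
    False := by
  have n5 := P.n5
  have m5 := P.m5
  have hm := P.hm
  have hn := P.hn
  have h1m : G.Adj (c 1) (d m) := P.perD h1 (by simp)
  have nb : ∀ r : ℤ, G.Adj (c r) (d 0) ∨ ∃ q : ℤ, 1 ≤ q ∧ q ≤ m - 1 ∧ G.Adj (c r) (d q) := by
    intro r
    obtain ⟨q, q1, q2, hq⟩ := P.nC 0 r
    by_cases e : q = 0
    · subst e; exact Or.inl hq
    · exact Or.inr ⟨q, by omega, by omega, hq⟩
  have two : ∀ r r' : ℤ, 2 ≤ r → r < r' → r' ≤ n - 1 →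
      (∃ q : ℤ, 1 ≤ q ∧ q ≤ m - 1 ∧ G.Adj (c r) (d q)) →
      (∃ q : ℤ, 1 ≤ q ∧ q ≤ m - 1 ∧ G.Adj (c r') (d q)) → r = 2 ∧ r' = n - 1 := by
    rintro r r' a1 a2 a3 ⟨q, q1, q2, hq⟩ ⟨q', q1', q2', hq'⟩
    have := P.RQ h0 h1m (by omega) (by omega) le_rfl a1 (by omega) (by omega) a3 q1 q2 q1' q2' hq hq'
    omega
  by_cases h7 : n = 5
  · subst h7
    have P' := P.shift 1 0
    by_cases h3 : G.Adj (c 3) (d 0)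
    · have n2 : ¬ G.Adj (c 2) (d 0) := fun h =>
        P.stepA h0 h1 (r := 2) (by omega) (by omega) h (by norm_num; exact h3)
      have n4 : ¬ G.Adj (c 4) (d 0) := fun h =>
        P.stepA h0 h1 (r := 3) (by omega) (by omega) h3 (by norm_num; exact h)
      obtain ⟨q, q1, q2, hq⟩ := (nb 2).resolve_left n2
      obtain ⟨q', q1', q2', hq'⟩ := (nb 4).resolve_left n4
      have := P.RQ h0 h1m (by omega) (by omega) le_rfl (r := 2) (r' := 4) (by omega) (by omega)
        (by omega) (by omega) q1 q2 q1' q2' hq hq'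
      by_cases e : q = 1
      · obtain rfl : q' = m - 1 := by omega
        subst e
        exact P.triA rfl h0 h1 h3 hq hq'
      · obtain rfl : q = m - 1 := by omega
        obtain rfl : q' = 1 := by omega
        refine P.negD.triA rfl ?_ ?_ ?_ ?_ ?_
        · simpa using h0
        · simpa using h1
        · simpa using h3
        · exact P.perD hq (by simp)
        · exact P.perD hq' (by simp)
    · have hq3 := (nb 3).resolve_left h3
      have e2 : G.Adj (c 2) (d 0) := (nb 2).resolve_right fun h => by
        have := two 2 3 (by omega) (by omega) (by omega) h hq3
        omega
      have e4 : G.Adj (c 4) (d 0) := (nb 4).resolve_right fun h => by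
        have := two 3 4 (by omega) (by omega) (by omega) hq3 h
        omega
      refine P'.stepA (r := 3) ?_ ?_ (by omega) (by omega) ?_ ?_
      · simpa using h1
      · simpa using e2
      · simpa using e4
      · exact P.perD (P.perC h0 (by norm_num)) (by norm_num)
  · have t34 := two 3 4 (by omega) (by omega) (by omega)
    have t45 := two 4 5 (by omega) (by omega) (by omega)
    have t46 := two 4 6 (by omega) (by omega) (by omega)
    have t35 := two 3 5 (by omega) (by omega) (by omega)
    by_cases h4 : ∃ q : ℤ, 1 ≤ q ∧ q ≤ m - 1 ∧ G.Adj (c 4) (d q)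
    · have e5 := (nb 5).resolve_right fun h => by have := t45 h4 h; omega
      have e6 := (nb 6).resolve_right fun h => by have := t46 h4 h; omega
      exact P.stepA h0 h1 (r := 5) (by omega) (by omega) e5 (by norm_num; exact e6)
    · have e4 := (nb 4).resolve_right h4
      by_cases h3 : ∃ q : ℤ, 1 ≤ q ∧ q ≤ m - 1 ∧ G.Adj (c 3) (d q)
      · have e5 := (nb 5).resolve_right fun h => by have := t35 h3 h; omega
        exact P.stepA h0 h1 (r := 4) (by omega) (by omega) e4 (by norm_num; exact e5)
      · have e3 := (nb 3).resolve_right h3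
        exact P.stepA h0 h1 (r := 3) (by omega) (by omega) e3 (by norm_num; exact e4)

lemma Pair.notri (P : Pair G n m c d) (h0 : G.Adj (c i) (d j)) (h1 : G.Adj (c (i + 1)) (d j)) :
    False := by
  refine (P.shift i j).notri0 ?_ ?_
  · simpa using h0
  · simpa [add_comm] using h1

lemma Pair.notri' (P : Pair G n m c d) (h0 : G.Adj (c i) (d j)) (h1 : G.Adj (c i) (d (j + 1))) :
    False := P.swap.notri h0.symm h1.symm

lemma cfg {t : ℤ} (H : ∀ c d : ℤ → V, Pair G n m c d → ∀ o : ℤ, G.Adj (c 0) (d 0) →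
    G.Adj (c 1) (d o) → o % 2 = 1 → 1 ≤ o → o ≤ m - 2 → o = t) (P : Pair G n m c d) {k : ℤ}
    (h0 : G.Adj (c i) (d j)) (h1 : G.Adj (c (i + 1)) (d k)) :
    (m : ℤ) ∣ k - j - t ∨ (m : ℤ) ∣ k - j + t := by
  have m5 := P.m5
  have hm := P.hm
  have r1 := Int.emod_nonneg (k - j) (b := m) (by omega)
  have r2 := Int.emod_lt_of_pos (k - j) (b := m) (by omega)
  have hd : (m : ℤ) ∣ (k - j) - (k - j) % m := Int.dvd_self_sub_emod
  generalize (k - j) % m = r at *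
  by_cases e0 : r = 0
  · subst e0
    exact (P.notri h0 (P.perD h1 (by simpa using hd))).elim
  by_cases e1 : r % 2 = 1
  · left
    have := H _ _ (P.shift i j) r (by simpa using h0)
      (by simpa [add_comm] using P.perD h1 (j' := j + r) (by rwa [← sub_sub]))
      e1 (by omega) (by omega)
    rwa [← this]
  · right
    have := H _ _ (P.shift i j).negD (m - r) (by simpa using h0)
      (by
        have := P.perD h1 (j' := -(m - r) + j) (by
          have e : k - (-(m - r) + j) = ((k - j) - r) + m := by ring
          rw [e]; exact hd.add (dvd_refl _))
        simpa [add_comm] using this)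
      (by omega) (by omega) (by omega)
    rw [← this, show k - j + (m - r) = ((k - j) - r) + m by ring]
    exact hd.add (dvd_refl _)

end CEC

namespace CEC
variable {V : Type*} {G : SimpleGraph V} {S T : Set V} {u v w : V} {k l : ℕ}
variable {n m : ℕ} {c d : ℤ → V}
variable {i i' j j' p p' q q' : ℤ}

/-- no cycle of length `k` -/
def NoC (G : SimpleGraph V) (k : ℕ) : Prop := ∀ S, ¬ CycIn G S k

lemma NoC.out (h : NoC G k) (P : Pair G n m c d) (X : XC G n m c d i i' j j')
    (e : (i' - i) + (j' - j) + 2 = k) : False :=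
  h _ ((X.cyc P).cast (by omega))

lemma no4_cfg (N : NoC G 4) (c d : ℤ → V) (P : Pair G n m c d) (o : ℤ)
    (h0 : G.Adj (c 0) (d 0)) (h1 : G.Adj (c 1) (d o)) (ho : o % 2 = 1) (o1 : 1 ≤ o)
    (o2 : o ≤ m - 2) : o = 3 := by
  have n5 := P.n5
  have m5 := P.m5
  by_contra hne
  by_cases e1 : o = 1
  · subst e1
    exact N.out P (i := 0) (i' := 1) (j := 0) (j' := 1)
      ⟨by omega, by omega, by omega, by omega, by omega, Or.inl ⟨h0, h1⟩⟩ (by norm_num)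
  have key : ∀ q : ℤ, ∃ s r : ℤ, (s = q ∨ s = q + 1) ∧ 2 ≤ r ∧ r ≤ n - 1 ∧ G.Adj (c r) (d s) := by
    intro q
    rcases or_assoc.2 (P.nD3 q) with h | ⟨r, a1, a2, a3⟩
    · rcases or_assoc.2 (P.nD3 (q + 1)) with h' | ⟨r, a1, a2, a3⟩
      · exfalso
        rcases h with h | h <;> rcases h' with h' | h'
        · exact P.notri' h h'
        · exact N.out P (i := 0) (i' := 1) (j := q) (j' := q + 1)
            ⟨by omega, by omega, by omega, by omega, by omega, Or.inl ⟨h, h'⟩⟩ (by push_cast; ring)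
        · exact N.out P (i := 0) (i' := 1) (j := q) (j' := q + 1)
            ⟨by omega, by omega, by omega, by omega, by omega, Or.inr ⟨h', h⟩⟩ (by push_cast; ring)
        · exact P.notri' h h'
      · exact ⟨q + 1, r, Or.inr rfl, a1, a2, a3⟩
    · exact ⟨q, r, Or.inl rfl, a1, a2, a3⟩
  obtain ⟨s1, r1, a1, b1, c1, e1⟩ := key 1
  obtain ⟨s2, r2, a2, b2, c2, e2⟩ := key 3
  obtain ⟨s3, r3, a3, b3, c3, e3⟩ := key 2
  have f1 := P.RQ h0 h1 ho o1 (by omega) b1 c1 b2 c2 (by omega) (by omega) (by omega) (by omega)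
    e1 e2
  have f2 := P.RQ h0 h1 ho o1 (by omega) b1 c1 b3 c3 (by omega) (by omega) (by omega) (by omega)
    e1 e3
  omega

lemma no4_main (N : NoC G 4) (P : Pair G n m c d) (h0 : G.Adj (c 0) (d 0))
    (h1 : G.Adj (c 1) (d 3)) : False := by
  have n5 := P.n5
  have m5 := P.m5
  have hm := P.hm
  have K1 : ∀ i j k : ℤ, G.Adj (c i) (d j) → G.Adj (c (i + 1)) (d k) →
      (m : ℤ) ∣ k - j - 3 ∨ (m : ℤ) ∣ k - j + 3 := fun i j k h h' => cfg (no4_cfg N) P h h'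
  have K2 : ∀ j i k : ℤ, G.Adj (c i) (d j) → G.Adj (c k) (d (j + 1)) →
      (n : ℤ) ∣ k - i - 3 ∨ (n : ℤ) ∣ k - i + 3 := fun j i k h h' =>
    cfg (no4_cfg N) P.swap h.symm h'.symm
  have e2 : G.Adj (c 2) (d 6) := by
    obtain ⟨k, hk⟩ := P.nbrC 2
    rcases K1 1 3 k h1 hk with h | h
    · exact P.perD hk (by rwa [show k - 6 = k - 3 - 3 by ring])
    · have := P.perD hk (j' := 0) (by rwa [show k - 0 = k - 3 + 3 by ring])
      exact (N.out P (i := 0) (i' := 2) (j := 0) (j' := 0)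
        ⟨by omega, by omega, by omega, by omega, by omega, Or.inl ⟨h0, this⟩⟩ (by norm_num)).elim
  have em1 : G.Adj (c (-1)) (d (-3)) := by
    obtain ⟨k, hk⟩ := P.nbrC (-1)
    rcases K1 (-1) k 0 hk h0 with h | h
    · exact P.perD hk (by rw [show k - -3 = -(0 - k - 3) by ring]; exact h.neg_right)
    · have := P.perD hk (j' := 3) (by rw [show k - 3 = -(0 - k + 3) by ring]; exact h.neg_right)
      exact (N.out P (i := -1) (i' := 1) (j := 3) (j' := 3)
        ⟨by omega, by omega, by omega, by omega, by omega, Or.inl ⟨this, h1⟩⟩ (by norm_num)).elim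
  have em2 : G.Adj (c (-2)) (d (-6)) := by
    obtain ⟨k, hk⟩ := P.nbrC (-2)
    rcases K1 (-2) k (-3) hk em1 with h | h
    · exact P.perD hk (by rw [show k - -6 = -(-3 - k - 3) by ring]; exact h.neg_right)
    · have := P.perD hk (j' := 0) (by rw [show k - 0 = -(-3 - k + 3) by ring]; exact h.neg_right)
      exact (N.out P (i := -2) (i' := 0) (j := 0) (j' := 0)
        ⟨by omega, by omega, by omega, by omega, by omega, Or.inl ⟨this, h0⟩⟩ (by norm_num)).elim
  obtain ⟨i, hi⟩ := P.nbrD 1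
  have small : ∀ a : ℕ, (m : ℤ) ∣ -(a : ℤ) → 0 < a → m ∣ a ∧ m ≤ a := by
    intro a h ha
    have : m ∣ a := by
      rw [Int.dvd_neg] at h
      exact_mod_cast h
    exact ⟨this, Nat.le_of_dvd ha this⟩
  rcases K2 0 0 i h0 hi with h | h
  · have e3 := P.perC hi (i' := 3) (by rwa [show i - 3 = i - 0 - 3 by ring])
    rcases K1 2 6 1 e2 e3 with h | h
    · obtain ⟨h, h'⟩ := small 8 (by simpa using h) (by norm_num)
      interval_cases m <;> omega
    · obtain ⟨h, h'⟩ := small 2 (by simpa using h) (by norm_num)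
      omega
  · have e3 := P.perC hi (i' := -3) (by rwa [show i - -3 = i - 0 + 3 by ring])
    rcases K1 (-3) 1 (-6) e3 em2 with h | h
    · obtain ⟨h, h'⟩ := small 10 (by simpa using h) (by norm_num)
      have : m = 5 := by interval_cases m <;> omega
      subst this
      have X : XC G n 5 c d 0 1 0 3 :=
        ⟨by omega, by omega, by omega, by omega, by omega, Or.inl ⟨h0, h1⟩⟩
      have Y : XC G n 5 c d 0 2 1 5 := ⟨by omega, by omega, by omega, by omega, by omega,
        Or.inr ⟨P.perD h0 (by norm_num), P.perD e2 (by norm_num)⟩⟩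
      exact P.lens X Y (by omega) (by omega)
    · obtain ⟨h, h'⟩ := small 4 (by simpa using h) (by norm_num)
      omega

lemma Pair.start {t : ℤ} (H : ∀ c d : ℤ → V, Pair G n m c d → ∀ o : ℤ, G.Adj (c 0) (d 0) →
    G.Adj (c 1) (d o) → o % 2 = 1 → 1 ≤ o → o ≤ m - 2 → o = t) (P : Pair G n m c d) :
    ∃ c d, Pair G n m c d ∧ G.Adj (c 0) (d 0) ∧ G.Adj (c 1) (d t) := by
  obtain ⟨j, hj⟩ := P.nbrC 0
  obtain ⟨k, hk⟩ := P.nbrC (0 + 1)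
  rcases cfg H P hj hk with h | h
  · refine ⟨_, _, P.shift 0 j, by simpa using hj, ?_⟩
    have := P.perD hk (j' := t + j) (by rwa [show k - (t + j) = k - j - t by ring])
    simpa using this
  · refine ⟨_, _, (P.shift 0 j).negD, by simpa using hj, ?_⟩
    have := P.perD hk (j' := -t + j) (by rwa [show k - (-t + j) = k - j + t by ring])
    simpa using this

lemma no6_cfg (N : NoC G 6) (c d : ℤ → V) (P : Pair G n m c d) (o : ℤ)
    (h0 : G.Adj (c 0) (d 0)) (h1 : G.Adj (c 1) (d o)) (ho : o % 2 = 1) (o1 : 1 ≤ o)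
    (o2 : o ≤ m - 2) : o = 1 := by
  have n5 := P.n5
  have m5 := P.m5
  by_contra hne
  by_cases e1 : o = 3
  · subst e1
    exact N.out P (i := 0) (i' := 1) (j := 0) (j' := 3)
      ⟨by omega, by omega, by omega, by omega, by omega, Or.inl ⟨h0, h1⟩⟩ (by norm_num)
  by_cases e5 : o = 5
  · subst e5
    have m7 : (7 : ℤ) ≤ m := by omega
    obtain ⟨r1, b1, c1, f1⟩ : ∃ r : ℤ, 2 ≤ r ∧ r ≤ n - 1 ∧ G.Adj (c r) (d 1) := by
      rcases P.nD3 1 with h | h | h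
      · exact (P.notri' h0 (by simpa using h)).elim
      · exact (N.out P (i := 1) (i' := 1) (j := 1) (j' := 5)
          ⟨by omega, by omega, by omega, by omega, by omega, Or.inl ⟨h, h1⟩⟩ (by norm_num)).elim
      · exact h
    obtain ⟨r4, b4, c4, f4⟩ : ∃ r : ℤ, 2 ≤ r ∧ r ≤ n - 1 ∧ G.Adj (c r) (d 4) := by
      rcases P.nD3 4 with h | h | h
      · exact (N.out P (i := 0) (i' := 0) (j := 0) (j' := 4)
          ⟨by omega, by omega, by omega, by omega, by omega, Or.inl ⟨h0, h⟩⟩ (by norm_num)).elim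
      · exact (P.notri' h (by norm_num; exact h1)).elim
      · exact h
    have rq := P.RQ h0 h1 ho o1 (by omega) b1 c1 b4 c4 (by omega) (by omega) (by omega) (by omega)
      f1 f4
    have f2 : G.Adj (c 1) (d 2) := by
      rcases P.nD3 2 with h | h | ⟨r, s1, s2, h⟩
      · exact (N.out P (i := 0) (i' := 1) (j := 2) (j' := 5)
          ⟨by omega, by omega, by omega, by omega, by omega, Or.inl ⟨h, h1⟩⟩ (by norm_num)).elim
      · exact h
      · have := P.RQ h0 h1 ho o1 (by omega) b1 c1 s1 s2 (by omega) (by omega) (by omega) (by omega)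
          f1 h
        omega
    have f3 : G.Adj (c 0) (d 3) := by
      rcases P.nD3 3 with h | h | ⟨r, s1, s2, h⟩
      · exact h
      · exact (N.out P (i := 0) (i' := 1) (j := 0) (j' := 3)
          ⟨by omega, by omega, by omega, by omega, by omega, Or.inl ⟨h0, h⟩⟩ (by norm_num)).elim
      · have := P.RQ h0 h1 ho o1 (by omega) b1 c1 s1 s2 (by omega) (by omega) (by omega) (by omega)
          f1 h
        omega
    by_cases e : r1 = 2
    · subst e
      exact (N.out P (i := 0) (i' := 2) (j := 1) (j' := 3)
          ⟨by omega, by omega, by omega, by omega, by omega, Or.inr ⟨f3, f1⟩⟩ (by norm_num)).elim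
    · obtain rfl : r1 = n - 1 := by omega
      obtain rfl : r4 = 2 := by omega
      have X : XC G n m c d (-1) 0 1 3 := ⟨by omega, by omega, by omega, by omega, by omega,
        Or.inl ⟨P.perC f1 (by simp), f3⟩⟩
      have Y : XC G n m c d 1 2 4 5 := ⟨by omega, by omega, by omega, by omega, by omega,
        Or.inr ⟨h1, f4⟩⟩
      exact P.clash X Y (by omega) (by omega) (by omega) (by omega) (by omega)
  have o7 : 7 ≤ o := by omega
  let A : ℤ → Prop := fun q => G.Adj (c 0) (d q) ∨ G.Adj (c 1) (d q)
  have win : ∀ q : ℤ, A q → A (q + 1) → A (q + 1 + 1) → A (q + 1 + 1 + 1) → False := by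
    intro q g0 g1 g2 g3
    rcases g0 with g0 | g0
    · have g1 := g1.resolve_left fun h => P.notri' g0 h
      have g2 := g2.resolve_right fun h => P.notri' g1 h
      have g3 := g3.resolve_left fun h => P.notri' g2 h
      exact N.out P (i := 0) (i' := 1) (j := q) (j' := q + 1 + 1 + 1)
        ⟨by omega, by omega, by omega, by omega, by omega, Or.inl ⟨g0, g3⟩⟩ (by push_cast; ring)
    · have g1 := g1.resolve_right fun h => P.notri' g0 h
      have g2 := g2.resolve_left fun h => P.notri' g1 h
      have g3 := g3.resolve_right fun h => P.notri' g2 h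
      exact N.out P (i := 0) (i' := 1) (j := q) (j' := q + 1 + 1 + 1)
        ⟨by omega, by omega, by omega, by omega, by omega, Or.inr ⟨g3, g0⟩⟩ (by push_cast; ring)
  have key : ∀ q : ℤ, ∃ s r : ℤ, ¬ A s ∧ (s = q ∨ s = q + 1 ∨ s = q + 1 + 1 ∨ s = q + 1 + 1 + 1) ∧
      2 ≤ r ∧ r ≤ n - 1 ∧ G.Adj (c r) (d s) := by
    intro q
    have : ∃ s, ¬ A s ∧ (s = q ∨ s = q + 1 ∨ s = q + 1 + 1 ∨ s = q + 1 + 1 + 1) := by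
      by_contra hno
      push Not at hno
      have g : ∀ s, (s = q ∨ s = q + 1 ∨ s = q + 1 + 1 ∨ s = q + 1 + 1 + 1) → A s := by
        intro s hs
        by_contra h
        have := hno s h
        omega
      exact win q (g _ (by omega)) (g _ (by omega)) (g _ (by omega)) (g _ (by omega))
    obtain ⟨s, hA, hs⟩ := this
    obtain ⟨r, h⟩ := (or_assoc.2 (P.nD3 s)).resolve_left hA
    exact ⟨s, r, hA, hs, h⟩
  obtain ⟨s1, r1, A1, a1, b1, c1, e1⟩ := key 0
  obtain ⟨s2, r2, A2, a2, b2, c2, e2⟩ := key (o - 3)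
  obtain ⟨s3, r3, A3, a3, b3, c3, e3⟩ := key 2
  have z1 : s1 ≠ 0 := by rintro rfl; exact A1 (Or.inl h0)
  have z2 : s2 ≠ o := by rintro rfl; exact A2 (Or.inr h1)
  have f1 := P.RQ h0 h1 ho o1 (by omega) b1 c1 b2 c2 (by omega) (by omega) (by omega) (by omega)
    e1 e2
  have f2 := P.RQ h0 h1 ho o1 (by omega) b1 c1 b3 c3 (by omega) (by omega) (by omega) (by omega)
    e1 e3
  omega

lemma no6_main (N : NoC G 6) (P : Pair G n m c d) (h0 : G.Adj (c 0) (d 0))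
    (h1 : G.Adj (c 1) (d 1)) : False := by
  have n5 := P.n5
  have m5 := P.m5
  have hn := P.hn
  have K1 : ∀ i j k : ℤ, G.Adj (c i) (d j) → G.Adj (c (i + 1)) (d k) →
      (m : ℤ) ∣ k - j - 1 ∨ (m : ℤ) ∣ k - j + 1 := fun i j k h h' => cfg (no6_cfg N) P h h'
  have s1 : ∀ i : ℤ, G.Adj (c i) (d 0) → G.Adj (c (i + 1)) (d 1) → G.Adj (c (i + 1 + 1)) (d 0) := by
    intro i g0 g1
    obtain ⟨k, hk⟩ := P.nbrC (i + 1 + 1)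
    rcases K1 _ _ _ g1 hk with h | h
    · have := P.perD hk (j' := 2) (by rwa [show k - 2 = k - 1 - 1 by ring])
      exact (N.out P (i := i) (i' := i + 1 + 1) (j := 0) (j' := 2)
        ⟨by omega, by omega, by omega, by omega, by omega, Or.inl ⟨g0, this⟩⟩
        (by push_cast; ring)).elim
    · exact P.perD hk (by rwa [show k - 0 = k - 1 + 1 by ring])
  have s2 : ∀ i : ℤ, G.Adj (c i) (d 1) → G.Adj (c (i + 1)) (d 0) → G.Adj (c (i + 1 + 1)) (d 1) := by
    intro i g0 g1
    obtain ⟨k, hk⟩ := P.nbrC (i + 1 + 1)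
    rcases K1 _ _ _ g1 hk with h | h
    · exact P.perD hk (by rwa [show k - 1 = k - 0 - 1 by ring])
    · have := P.perD hk (j' := -1) (by rwa [show k - -1 = k - 0 + 1 by ring])
      exact (N.out P (i := i) (i' := i + 1 + 1) (j := -1) (j' := 1)
        ⟨by omega, by omega, by omega, by omega, by omega, Or.inr ⟨g0, this⟩⟩
        (by push_cast; ring)).elim
  have ind : ∀ k : ℕ, G.Adj (c (2 * k)) (d 0) ∧ G.Adj (c (2 * k + 1)) (d 1) := by
    intro k
    induction k with
    | zero => exact ⟨by simpa using h0, by simpa using h1⟩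
    | succ k ih =>
      have a := s1 _ ih.1 ih.2
      have b := s2 _ ih.2 a
      have e : (2 * ((k + 1 : ℕ) : ℤ)) = 2 * k + 1 + 1 := by push_cast; ring
      rw [e]
      exact ⟨a, b⟩
  have := (ind (n / 2)).2
  have g : G.Adj (c 0) (d (0 + 1)) := by
    refine P.perC this (i' := 0) ⟨1, ?_⟩
    push_cast
    omega
  exact P.notri' h0 g

lemma Pair.false (P : Pair G n m c d) : False := by
  by_cases N4 : NoC G 4
  · obtain ⟨c, d, P, h0, h1⟩ := P.start (no4_cfg N4)
    exact no4_main N4 P h0 h1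
  · have N6 : NoC G 6 := by
      intro S hS
      apply N4
      intro T hT
      exact P.no (hasTwo hT hS (by norm_num))
    obtain ⟨c, d, P, h0, h1⟩ := P.start (no6_cfg N6)
    exact no6_main N6 P h0 h1

end CEC

/-- A 3-connected graph with two vertex-disjoint odd cycles contains two cycles of
consecutive even lengths. -/
theorem stmt_9 {V : Type*} [Fintype V] (G : SimpleGraph V) (h3 : KConnected 3 G)
    {x z : V} (b : G.Walk x x) (d : G.Walk z z) (hb : b.IsCycle) (hd : d.IsCycle)
    (hbo : Odd b.length) (hdo : Odd d.length)
    (hdisj : ∀ v ∈ b.support, v ∉ d.support) :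
    HasTwoConsecEvenCycles G := by
  by_contra hno
  obtain ⟨c, hc, hcs⟩ := CEC.CycSeq.of_walk hb
  obtain ⟨e, he, hes⟩ := CEC.CycSeq.of_walk hd
  have hs := CEC.KConnected.sep3 h3
  have P : CEC.Pair G b.length d.length c e :=
    ⟨hno, hs, fun S T k k' h1 h2 h3 h4 h5 => hno (CEC.thmE hs h1 h2 h3 h4 h5), hc, he,
      Nat.odd_iff.1 hbo, Nat.odd_iff.1 hdo, fun i j h => hdisj _ (hcs i) (h ▸ hes j)⟩
  exact P.false
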